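/- There exists a polynomial p such that for every n-vertex (theta, pyramid)-free graph G and every pair of non-adjacent vertices a, b of G, there is a set C ⊆ V(G) \ {a, b} with |C| ≤ p(ω(G))·log n such that a and b lie in different connected components of G \ C. -/

import Mathlib

open SimpleGraph

namespace Paper

variable {V : Type*}

/-- `S` is an independent (stable) set in `G`. -/
def IsIndep (G : SimpleGraph V) (S : Set V) : Prop :=
  ∀ ⦃a⦄, a ∈ S → ∀ ⦃b⦄, b ∈ S → a ≠ b → ¬ G.Adj a b

/-- The independence number of `S` is at most `k`. -/
def IndepNumLE (G : SimpleGraph V) (S : Set V) (k : ℕ) : Prop :=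
  ∀ T : Finset V, ↑T ⊆ S → IsIndep G ↑T → T.card ≤ k

/-- There are no edges between `A` and `B`. -/
def Anticomplete (G : SimpleGraph V) (A B : Set V) : Prop :=
  ∀ ⦃a⦄, a ∈ A → ∀ ⦃b⦄, b ∈ B → ¬ G.Adj a b

/-- `G` has no induced `K_{t,t}`. -/
def KttFree (G : SimpleGraph V) (t : ℕ) : Prop :=
  ¬ ∃ A B : Finset V, Disjoint A B ∧ A.card = t ∧ B.card = t ∧
      IsIndep G ↑A ∧ IsIndep G ↑B ∧ ∀ a ∈ A, ∀ b ∈ B, G.Adj a b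

/-- `P` is an induced path in `G`. -/
def IsInducedPathW (G : SimpleGraph V) {a b : V} (P : G.Walk a b) : Prop :=
  P.IsPath ∧ ∀ u ∈ P.support, ∀ v ∈ P.support, G.Adj u v → s(u, v) ∈ P.edges

/-- The interior of a path: its support minus the two ends. -/
def interiorSet (G : SimpleGraph V) {a b : V} (P : G.Walk a b) : Set V :=
  {v | v ∈ P.support ∧ v ≠ a ∧ v ≠ b}

/-- `G` contains a theta as an induced subgraph. -/
def ContainsTheta (G : SimpleGraph V) : Prop :=
  ∃ (a b : V) (P₁ P₂ P₃ : G.Walk a b),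
    a ≠ b ∧ ¬ G.Adj a b ∧
    IsInducedPathW G P₁ ∧ IsInducedPathW G P₂ ∧ IsInducedPathW G P₃ ∧
    2 ≤ P₁.length ∧ 2 ≤ P₂.length ∧ 2 ≤ P₃.length ∧
    Disjoint (interiorSet G P₁) (interiorSet G P₂) ∧
    Disjoint (interiorSet G P₁) (interiorSet G P₃) ∧
    Disjoint (interiorSet G P₂) (interiorSet G P₃) ∧
    Anticomplete G (interiorSet G P₁) (interiorSet G P₂) ∧
    Anticomplete G (interiorSet G P₁) (interiorSet G P₃) ∧
    Anticomplete G (interiorSet G P₂) (interiorSet G P₃)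

def ThetaFree (G : SimpleGraph V) : Prop := ¬ ContainsTheta G

/-- `G` contains a pyramid as an induced subgraph. -/
def ContainsPyramid (G : SimpleGraph V) : Prop :=
  ∃ (a : V) (b : Fin 3 → V) (P : ∀ i : Fin 3, G.Walk a (b i)),
    Function.Injective b ∧
    (∀ i j : Fin 3, i ≠ j → G.Adj (b i) (b j)) ∧
    (∀ i, IsInducedPathW G (P i)) ∧
    (∀ i, 1 ≤ (P i).length) ∧
    (∀ i j : Fin 3, i ≠ j → (P i).length = 1 → (P j).length ≠ 1) ∧
    (∀ i j : Fin 3, i ≠ j → ∀ v, v ∈ (P i).support → v ∈ (P j).support → v = a) ∧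
    (∀ i j : Fin 3, i ≠ j → ∀ u ∈ (P i).support, ∀ v ∈ (P j).support,
      u ≠ a → v ≠ a → G.Adj u v → u = b i ∧ v = b j)

def PyramidFree (G : SimpleGraph V) : Prop := ¬ ContainsPyramid G

/-- Open neighborhood of a set. -/
def nbhdS (G : SimpleGraph V) (X : Set V) : Set V := {v | v ∉ X ∧ ∃ x ∈ X, G.Adj x v}

/-- Closed neighborhood of a set. -/
def nbhdC (G : SimpleGraph V) (X : Set V) : Set V := X ∪ nbhdS G X

/-- The boundary of `X` inside the induced subgraph `G[U]`. -/
def delta1 (G : SimpleGraph V) (U X : Set V) : Set V :=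
  {v | v ∈ X ∧ ∃ u ∈ U \ X, G.Adj v u}

def delta2 (G : SimpleGraph V) (U X : Set V) : Set V := delta1 G U (X \ delta1 G U X)

/-- `S` induces a connected subgraph. -/
def ConnSet (G : SimpleGraph V) (S : Set V) : Prop := (G.induce S).Connected

/-- `X` is a cooperative set in the induced subgraph `G[U]`. -/
def Cooperative (G : SimpleGraph V) (U X : Set V) : Prop :=
  X ⊆ U ∧ ConnSet G X ∧
  (∀ v ∈ delta1 G U X, ∃ u ∈ X \ delta1 G U X, G.Adj v u) ∧
  (∀ v ∈ delta2 G U X, ∃ u ∈ X \ (delta1 G U X ∪ delta2 G U X), G.Adj v u) ∧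
  ConnSet G (X \ (delta1 G U X ∪ delta2 G U X))

/-- The finite set `A` is matched into `B` by a matching of `G`. -/
def MatchedInto (G : SimpleGraph V) (A : Finset V) (B : Set V) : Prop :=
  ∃ f : V → V, Set.InjOn f ↑A ∧ ∀ a ∈ A, f a ∈ B ∧ G.Adj a (f a)

/-- There are `|A|` paths from `A` to `b`, pairwise vertex-disjoint except at `b`,
internally disjoint from `N[X]`. -/
def LinkedTo (G : SimpleGraph V) (X : Set V) (A : Finset V) (b : V) : Prop :=
  ∃ P : ∀ a ∈ A, G.Walk a b,
    (∀ a (ha : a ∈ A), (P a ha).IsPath) ∧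
    (∀ a (ha : a ∈ A), ∀ v ∈ (P a ha).support, v ≠ a → v ≠ b → v ∉ nbhdC G X) ∧
    (∀ a (ha : a ∈ A), ∀ a' (ha' : a' ∈ A), a ≠ a' →
      ∀ v, v ∈ (P a ha).support → v ∈ (P a' ha').support → v = b)

/-- `(S, I)` is a matroid. -/
def IsMatroid [DecidableEq V] (S : Set V) (I : Set (Finset V)) : Prop :=
  (∅ ∈ I) ∧ (∀ A ∈ I, ↑A ⊆ S) ∧
  (∀ A B : Finset V, A ⊆ B → B ∈ I → A ∈ I) ∧
  (∀ A B : Finset V, A ∈ I → B ∈ I → A.card < B.card → ∃ x ∈ B, x ∉ A ∧ insert x A ∈ I)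

/-- `D` is a connected component of `G` minus the set `avoid`. -/
def IsCompAvoiding (G : SimpleGraph V) (avoid D : Set V) : Prop :=
  D ⊆ avoidᶜ ∧ ConnSet G D ∧ ∀ u, u ∉ D → u ∉ avoid → ¬ ∃ d ∈ D, G.Adj u d

/-- `Z` is a constricted set. -/
def Constricted (G : SimpleGraph V) (Z : Set V) : Prop :=
  IsIndep G Z ∧ ∀ S : Set V, (G.induce S).IsTree → (Z ∩ S).ncard ≤ 2

end Paper




open SimpleGraph

namespace Sep
open Classical

variable {V : Type*} {G : SimpleGraph V}

/-- `v` is reachable from `u` inside `S`. -/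
def RR (G : SimpleGraph V) (S : Set V) (u v : V) : Prop :=
  u ∈ S ∧ Relation.ReflTransGen (fun x y => G.Adj x y ∧ y ∈ S) u v

theorem RR.left {S : Set V} {u v : V} (h : RR G S u v) : u ∈ S := h.1

theorem RR.right {S : Set V} {u v : V} (h : RR G S u v) : v ∈ S := by
  obtain ⟨h1, h2⟩ := h
  induction h2 with
  | refl => exact h1
  | tail _ h _ => exact h.2

theorem RR.refl {S : Set V} {u : V} (h : u ∈ S) : RR G S u u := ⟨h, .refl⟩

theorem RR.tail {S : Set V} {u v w : V} (h : RR G S u v) (a : G.Adj v w) (hw : w ∈ S) :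
    RR G S u w := ⟨h.1, h.2.tail ⟨a, hw⟩⟩

theorem RR.trans {S : Set V} {u v w : V} (h : RR G S u v) (h' : RR G S v w) :
    RR G S u w := ⟨h.1, h.2.trans h'.2⟩

theorem RR.edge {S : Set V} {u v : V} (hu : u ∈ S) (hv : v ∈ S) (a : G.Adj u v) : RR G S u v :=
  (RR.refl hu).tail a hv

theorem RR.ind {S : Set V} {u v : V} (h : RR G S u v) (X : Set V) (hu : u ∈ X)
    (hX : ∀ x ∈ X, ∀ y ∈ S, G.Adj x y → y ∈ X) : v ∈ X := by
  obtain ⟨h1, h2⟩ := h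
  induction h2 with
  | refl => exact hu
  | tail _ h ih => exact hX _ ih _ h.2 h.1

theorem RR.symm {S : Set V} {u v : V} (h : RR G S u v) : RR G S v u := by
  have : v ∈ {w | RR G S w u} := by
    refine h.ind _ (RR.refl h.1) ?_
    intro x hx y hy a
    exact (RR.edge hy hx.left a.symm).trans hx
  exact this

theorem RR.mono {S S' : Set V} {u v : V} (h : RR G S u v) (hS : S ⊆ S') : RR G S' u v := by
  have : v ∈ {w | RR G S' u w} := by
    refine h.ind _ (RR.refl (hS h.1)) ?_
    intro x hx y hy a
    exact hx.tail a (hS hy)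
  exact this

def comp (G : SimpleGraph V) (S : Set V) (b : V) : Set V := {v | RR G S b v}

def Conn (G : SimpleGraph V) (S : Set V) : Prop := ∀ u ∈ S, ∀ v ∈ S, RR G S u v

theorem comp_sub {S : Set V} {b : V} : comp G S b ⊆ S := fun _ h => RR.right h

theorem comp_self {S : Set V} {b : V} (h : b ∈ S) : b ∈ comp G S b := RR.refl h

theorem comp_step {S : Set V} {b v w : V} (h : v ∈ comp G S b) (a : G.Adj v w) (hw : w ∈ S) :
    w ∈ comp G S b := RR.tail h a hw

theorem RR.comp {S : Set V} {b v : V} (h : RR G S b v) : RR G (comp G S b) b v := by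
  have : v ∈ {w | RR G (Sep.comp G S b) b w} := by
    refine h.ind _ (RR.refl (RR.refl h.1)) ?_
    intro x hx y hy a
    exact RR.tail hx a (comp_step (RR.right hx) a hy)
  exact this

theorem comp_conn {S : Set V} {b : V} : Conn G (comp G S b) := by
  intro u hu v hv
  exact (RR.comp hu).symm.trans (RR.comp hv)

theorem conn_sub_comp {S X : Set V} {b : V} (hX : Conn G X) (hb : b ∈ X) (h : X ⊆ S) :
    X ⊆ comp G S b := fun v hv => (hX b hb v hv).mono h

theorem comp_mono {S S' : Set V} {b : V} (h : S ⊆ S') : comp G S b ⊆ comp G S' b :=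
  fun _ hv => RR.mono hv h

theorem comp_sub_of {S S' : Set V} {b : V} (h : comp G S b ⊆ S') : comp G S b ⊆ comp G S' b :=
  fun _ hv => (RR.comp hv).mono h

theorem conn_union {X Y : Set V} {z : V} (hX : Conn G X) (hY : Conn G Y) (h1 : z ∈ X) (h2 : z ∈ Y) :
    Conn G (X ∪ Y) := by
  have key : ∀ u ∈ X ∪ Y, RR G (X ∪ Y) u z := by
    rintro u (hu | hu)
    · exact (hX u hu z h1).mono Set.subset_union_left
    · exact (hY u hu z h2).mono Set.subset_union_right
  intro u hu v hv
  exact (key u hu).trans (key v hv).symm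

theorem conn_union_adj {X Y : Set V} {x y : V} (hX : Conn G X) (hY : Conn G Y) (h1 : x ∈ X)
    (h2 : y ∈ Y) (a : G.Adj x y) : Conn G (X ∪ Y) := by
  have key : ∀ u ∈ X ∪ Y, RR G (X ∪ Y) u x := by
    rintro u (hu | hu)
    · exact (hX u hu x h1).mono Set.subset_union_left
    · exact ((hY u hu y h2).mono Set.subset_union_right).tail a.symm (Or.inl h1)
  intro u hu v hv
  exact (key u hu).trans (key v hv).symm

theorem conn_singleton (x : V) : Conn G {x} := by
  rintro u rfl v rfl
  exact RR.refl rfl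

theorem conn_insert {X : Set V} {x y : V} (hX : Conn G X) (h1 : x ∈ X) (a : G.Adj x y) :
    Conn G (insert y X) := by
  have := conn_union_adj (conn_singleton (G := G) y) hX rfl h1 a.symm
  rwa [Set.singleton_union] at this

/-- induced path given as a function -/
structure IPath (G : SimpleGraph V) (p : ℕ → V) (n : ℕ) : Prop where
  inj : ∀ i j, i < j → j ≤ n → p i ≠ p j
  adj : ∀ i < n, G.Adj (p i) (p (i+1))
  nadj : ∀ i j, i + 1 < j → j ≤ n → ¬ G.Adj (p i) (p j)

/-- walk of length n as a function -/
def FW (G : SimpleGraph V) (S : Set V) (p : ℕ → V) (n : ℕ) : Prop :=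
  (∀ i ≤ n, p i ∈ S) ∧ ∀ i < n, G.Adj (p i) (p (i+1))

theorem RR.fw {S : Set V} {u v : V} (h : RR G S u v) :
    ∃ n p, FW G S p n ∧ p 0 = u ∧ p n = v := by
  have : v ∈ {w | ∃ n p, FW G S p n ∧ p 0 = u ∧ p n = w} := by
    refine h.ind _ ⟨0, fun _ => u, ⟨fun _ _ => h.1, by simp⟩, rfl, rfl⟩ ?_
    rintro x ⟨n, p, ⟨h1, h2⟩, h3, h4⟩ y hy a
    refine ⟨n+1, fun i => if i ≤ n then p i else y, ⟨?_, ?_⟩, by simp [h3], by simp⟩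
    · intro i hi
      by_cases h : i ≤ n <;> simp [h, hy]
      exact h1 i h
    · intro i hi
      have : i ≤ n := by omega
      by_cases h : i + 1 ≤ n
      · simpa [h, this] using h2 i (by omega)
      · have : i = n := by omega
        subst this
        simpa [h4] using a
  exact this

/-- shortest path from `u` to the predicate `Z` -/
theorem shortest {S : Set V} {u v : V} (Z : V → Prop) (h : RR G S u v) (hv : Z v) :
    ∃ n p, FW G S p n ∧ p 0 = u ∧ Z (p n) ∧ (∀ i < n, ¬ Z (p i)) ∧ IPath G p n := by
  have hex : ∃ n, ∃ p, FW G S p n ∧ p 0 = u ∧ Z (p n) := by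
    obtain ⟨n, p, h1, h2, h3⟩ := h.fw
    exact ⟨n, p, h1, h2, h3 ▸ hv⟩
  obtain ⟨p, hp, hp0, hpn⟩ := Nat.find_spec hex
  have hmin := fun m (hm : m < Nat.find hex) => Nat.find_min hex hm
  set n := Nat.find hex with hn
  -- cutting lemma: from i jump to j
  have cut : ∀ i j, i + 1 < j → j ≤ n → G.Adj (p i) (p j) → False := by
    intro i j hij hj a
    refine hmin (n - (j - i - 1)) (by omega)
      ⟨fun k => if k ≤ i then p k else p (k + (j - i - 1)), ⟨?_, ?_⟩, by simp [hp0], ?_⟩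
    · intro k hk
      by_cases h : k ≤ i <;> simp only [h, if_true, if_false]
      · exact hp.1 k (by omega)
      · exact hp.1 _ (by omega)
    · intro k hk
      by_cases h : k + 1 ≤ i
      · have h' : k ≤ i := by omega
        simp only [h, h', if_true]
        exact hp.2 k (by omega)
      · by_cases h' : k ≤ i
        · have : k = i := by omega
          subst this
          simp only [h, h', if_true, if_false]
          have : k + 1 + (j - k - 1) = j := by omega
          rwa [this]
        · simp only [h, h', if_false]
          have := hp.2 (k + (j - i - 1)) (by omega)
          rwa [show k + 1 + (j - i - 1) = k + (j - i - 1) + 1 by omega]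
    · have : ¬ (n - (j - i - 1) ≤ i) := by omega
      simp only [this, if_false]
      rwa [show n - (j - i - 1) + (j - i - 1) = n by omega]
  refine ⟨n, p, hp, hp0, hpn, ?_, ?_, hp.2, cut⟩
  · intro i hi hz
    exact hmin i hi ⟨p, ⟨fun k hk => hp.1 k (by omega), fun k hk => hp.2 k (by omega)⟩, hp0, hz⟩
  · intro i j hij hj e
    by_cases hjn : j = n
    · subst hjn
      exact hmin i hij ⟨p, ⟨fun k hk => hp.1 k (by omega), fun k hk => hp.2 k (by omega)⟩, hp0,
        e ▸ hpn⟩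
    · exact cut i (j+1) (by omega) (by omega) (e ▸ hp.2 j (by omega))

theorem rr_of_fun {p : ℕ → V} {S : Set V} (i j : ℕ) (hij : i ≤ j) (hS : ∀ k, i ≤ k → k ≤ j → p k ∈ S)
    (ha : ∀ k, i ≤ k → k < j → G.Adj (p k) (p (k+1))) : RR G S (p i) (p j) := by
  induction j, hij using Nat.le_induction with
  | base => exact RR.refl (hS i le_rfl le_rfl)
  | succ j hij ih =>
    exact (ih (fun k h1 h2 => hS k h1 (by omega)) (fun k h1 h2 => ha k h1 (by omega))).tail
      (ha j hij (by omega)) (hS _ (by omega) le_rfl)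

theorem conn_of_fun {p : ℕ → V} (n : ℕ) (ha : ∀ k, k < n → G.Adj (p k) (p (k+1))) :
    Conn G {v | ∃ i ≤ n, v = p i} := by
  have key : ∀ u ∈ {v | ∃ i ≤ n, v = p i}, RR G {v | ∃ i ≤ n, v = p i} (p 0) u := by
    rintro u ⟨i, hi, rfl⟩
    exact rr_of_fun 0 i (by omega) (fun k _ hk => ⟨k, by omega, rfl⟩) (fun k _ hk => ha k (by omega))
  intro u hu v hv
  exact (key u hu).symm.trans (key v hv)

theorem walk_of_ipath {p : ℕ → V} (n : ℕ) (h : IPath G p n) :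
    ∃ W : G.Walk (p 0) (p n), Paper.IsInducedPathW G W ∧ W.length = n ∧
      ∀ v, v ∈ W.support ↔ ∃ i ≤ n, v = p i := by
  have key : ∀ m ≤ n, ∃ W : G.Walk (p 0) (p m), W.IsPath ∧ W.length = m ∧
      (∀ v, v ∈ W.support ↔ ∃ i ≤ m, v = p i) ∧ ∀ i < m, s(p i, p (i+1)) ∈ W.edges := by
    intro m
    induction m with
    | zero =>
      intro _
      refine ⟨Walk.nil, by simp, by simp, ?_, by simp⟩
      intro v
      simp
    | succ m ih =>
      intro hm
      obtain ⟨W, h1, h2, h3, h4⟩ := ih (by omega)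
      refine ⟨W.concat (h.adj m (by omega)), ?_, by simp [h2], ?_, ?_⟩
      · refine h1.concat ?_ _
        rw [h3]
        rintro ⟨i, hi, e⟩
        exact h.inj i (m+1) (by omega) hm e.symm
      · intro v
        simp only [Walk.support_concat, List.mem_append, List.mem_singleton, h3]
        constructor
        · rintro (⟨i, hi, e⟩ | e)
          · exact ⟨i, by omega, e⟩
          · exact ⟨m+1, le_rfl, e⟩
        · rintro ⟨i, hi, e⟩
          by_cases h : i = m + 1
          · subst h; exact Or.inr e
          · exact Or.inl ⟨i, by omega, e⟩
      · intro i hi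
        simp only [Walk.edges_concat, List.concat_eq_append, List.mem_append, List.mem_singleton]
        by_cases h : i = m
        · subst h; exact Or.inr rfl
        · exact Or.inl (h4 i (by omega))
  obtain ⟨W, h1, h2, h3, h4⟩ := key n le_rfl
  refine ⟨W, ⟨h1, ?_⟩, h2, h3⟩
  intro u hu v hv a
  obtain ⟨i, hi, rfl⟩ := (h3 u).1 hu
  obtain ⟨j, hj, rfl⟩ := (h3 v).1 hv
  rcases lt_trichotomy i j with hij | hij | hij
  · by_cases e : j = i + 1
    · subst e; exact h4 i (by omega)
    · exact absurd a (h.nadj i j (by omega) hj)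
  · subst hij; exact absurd a (G.irrefl)
  · by_cases e : i = j + 1
    · subst e; rw [Sym2.eq_swap]; exact h4 j (by omega)
    · exact absurd a.symm (h.nadj j i (by omega) hi)

theorem ind_walk {S : Set V} {u v : V} (h : RR G S u v) :
    ∃ W : G.Walk u v, Paper.IsInducedPathW G W ∧ ∀ x ∈ W.support, x ∈ S := by
  obtain ⟨n, p, h1, h2, h3, h4, h5⟩ := shortest (fun x => x = v) h rfl
  obtain ⟨W, h6, h7, h8⟩ := walk_of_ipath n h5
  subst h2
  subst h3
  refine ⟨W, h6, ?_⟩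
  intro x hx
  obtain ⟨i, hi, rfl⟩ := (h8 x).1 hx
  exact h1.1 i hi

theorem theta_of (hG : Paper.ThetaFree G) {u w : V} (huw : u ≠ w) (hn : ¬ G.Adj u w)
    (A1 A2 A3 : Set V) (r1 : RR G (A1 ∪ {u, w}) u w) (r2 : RR G (A2 ∪ {u, w}) u w)
    (r3 : RR G (A3 ∪ {u, w}) u w)
    (d12 : Disjoint A1 A2) (d13 : Disjoint A1 A3) (d23 : Disjoint A2 A3)
    (n12 : Paper.Anticomplete G A1 A2) (n13 : Paper.Anticomplete G A1 A3)
    (n23 : Paper.Anticomplete G A2 A3) : False := by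
  have len : ∀ W : G.Walk u w, 2 ≤ W.length := by
    intro W
    by_contra hlt
    have : W.length = 0 ∨ W.length = 1 := by omega
    rcases this with h | h
    · exact huw (Walk.eq_of_length_eq_zero h)
    · exact hn (Walk.adj_of_length_eq_one h)
  obtain ⟨W1, i1, s1⟩ := ind_walk r1
  obtain ⟨W2, i2, s2⟩ := ind_walk r2
  obtain ⟨W3, i3, s3⟩ := ind_walk r3
  have aux : ∀ (A : Set V) (W : G.Walk u w), (∀ x ∈ W.support, x ∈ A ∪ {u, w}) →
      Paper.interiorSet G W ⊆ A := by
    rintro A W h x ⟨hx, h1, h2⟩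
    rcases h x hx with h | h | h
    · exact h
    · exact absurd h h1
    · exact absurd h h2
  have j1 := aux _ _ s1
  have j2 := aux _ _ s2
  have j3 := aux _ _ s3
  exact hG ⟨u, w, W1, W2, W3, huw, hn, i1, i2, i3, len _, len _, len _,
    d12.mono j1 j2, d13.mono j1 j3, d23.mono j2 j3,
    fun a ha b hb => n12 (j1 ha) (j2 hb), fun a ha b hb => n13 (j1 ha) (j3 hb),
    fun a ha b hb => n23 (j2 ha) (j3 hb)⟩

theorem pyramid_of (hG : Paper.PyramidFree G) (a : V) (b : Fin 3 → V) (A : Fin 3 → Set V)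
    (hb : ∀ i j : Fin 3, i ≠ j → G.Adj (b i) (b j))
    (hab : ∀ i, a ≠ b i)
    (hr : ∀ i, RR G (insert a (A i)) a (b i))
    (h1 : ∀ i j : Fin 3, i ≠ j → G.Adj a (b i) → ¬ G.Adj a (b j))
    (hd : ∀ i j : Fin 3, i ≠ j → Disjoint (A i) (A j))
    (he : ∀ i j : Fin 3, i ≠ j → ∀ u ∈ A i, ∀ v ∈ A j, G.Adj u v → u = b i ∧ v = b j) : False := by
  choose W hW hs using fun i => ind_walk (hr i)
  have hs' : ∀ i, ∀ x ∈ (W i).support, x ≠ a → x ∈ A i := by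
    intro i x hx hxa
    exact (hs i x hx).resolve_left hxa
  refine hG ⟨a, b, W, ?_, hb, hW, ?_, ?_, ?_, ?_⟩
  · intro i j e
    by_contra hij
    exact (hb i j hij).ne e
  · intro i
    by_contra h
    have : (W i).length = 0 := by omega
    exact hab i (Walk.eq_of_length_eq_zero this)
  · intro i j hij h h'
    exact h1 i j hij (Walk.adj_of_length_eq_one h) (Walk.adj_of_length_eq_one h')
  · intro i j hij v hv hv'
    by_contra hva
    exact Set.disjoint_left.1 (hd i j hij) (hs' i v hv hva) (hs' j v hv' hva)
  · intro i j hij u hu v hv hua hva adj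
    exact he i j hij u (hs' i u hu hua) v (hs' j v hv hva) adj

end Sep

open SimpleGraph

namespace Sep
open Classical

variable {V : Type*} {G : SimpleGraph V}

theorem pyramid_of3 (hP : Paper.PyramidFree G) (c b0 b1 b2 : V) (A0 A1 A2 : Set V)
    (t01 : G.Adj b0 b1) (t02 : G.Adj b0 b2) (t12 : G.Adj b1 b2)
    (c0 : c ≠ b0) (c1 : c ≠ b1) (c2 : c ≠ b2)
    (r0 : RR G (insert c A0) c b0) (r1 : RR G (insert c A1) c b1) (r2 : RR G (insert c A2) c b2)
    (Z1 : G.Adj c b0 → ¬ G.Adj c b1) (Z2 : G.Adj c b0 → ¬ G.Adj c b2)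
    (Z3 : G.Adj c b1 → ¬ G.Adj c b2)
    (X1 : ∀ u ∈ A0, ∀ v ∈ A1, u ≠ v ∧ (G.Adj u v → u = b0 ∧ v = b1))
    (X2 : ∀ u ∈ A0, ∀ v ∈ A2, u ≠ v ∧ (G.Adj u v → u = b0 ∧ v = b2))
    (X3 : ∀ u ∈ A1, ∀ v ∈ A2, u ≠ v ∧ (G.Adj u v → u = b1 ∧ v = b2)) : False := by
  have D1 := Set.disjoint_left.2 (fun x hx hx' => (X1 x hx x hx').1 rfl)
  have D2 := Set.disjoint_left.2 (fun x hx hx' => (X2 x hx x hx').1 rfl)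
  have D3 := Set.disjoint_left.2 (fun x hx hx' => (X3 x hx x hx').1 rfl)
  refine pyramid_of hP c ![b0, b1, b2] ![A0, A1, A2] ?_ ?_ ?_ ?_ ?_ ?_
  · intro i j hij
    fin_cases i <;> fin_cases j
    · exact absurd rfl hij
    · exact t01
    · exact t02
    · exact t01.symm
    · exact absurd rfl hij
    · exact t12
    · exact t02.symm
    · exact t12.symm
    · exact absurd rfl hij
  · intro i
    fin_cases i
    · exact c0
    · exact c1
    · exact c2
  · intro i
    fin_cases i
    · exact r0
    · exact r1
    · exact r2
  · intro i j hij
    fin_cases i <;> fin_cases j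
    · exact absurd rfl hij
    · exact Z1
    · exact Z2
    · exact fun a b => Z1 b a
    · exact absurd rfl hij
    · exact Z3
    · exact fun a b => Z2 b a
    · exact fun a b => Z3 b a
    · exact absurd rfl hij
  · intro i j hij
    fin_cases i <;> fin_cases j
    · exact absurd rfl hij
    · exact D1
    · exact D2
    · exact D1.symm
    · exact absurd rfl hij
    · exact D3
    · exact D2.symm
    · exact D3.symm
    · exact absurd rfl hij
  · intro i j hij u hu v hv a
    fin_cases i <;> fin_cases j
    · exact absurd rfl hij
    · exact (X1 u hu v hv).2 a
    · exact (X2 u hu v hv).2 a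
    · exact ((X1 v hv u hu).2 a.symm).symm
    · exact absurd rfl hij
    · exact (X3 u hu v hv).2 a
    · exact ((X2 v hv u hu).2 a.symm).symm
    · exact ((X3 v hv u hu).2 a.symm).symm
    · exact absurd rfl hij

set_option maxHeartbeats 1000000 in
theorem lemmaA (hT : Paper.ThetaFree G) (hP : Paper.PyramidFree G) {c u1 u2 u3 : V} {D : Set V}
    (a1 : G.Adj c u1) (a2 : G.Adj c u2) (a3 : G.Adj c u3)
    (e12 : u1 ≠ u2) (e13 : u1 ≠ u3) (e23 : u2 ≠ u3)
    (n12 : ¬ G.Adj u1 u2) (n13 : ¬ G.Adj u1 u3) (n23 : ¬ G.Adj u2 u3)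
    (hD : Conn G D) (hc : c ∉ D) (hcD : ∀ d ∈ D, ¬ G.Adj c d)
    (t1 : ∃ d ∈ D, G.Adj u1 d) (t2 : ∃ d ∈ D, G.Adj u2 d) (t3 : ∃ d ∈ D, G.Adj u3 d)
    (c1 : ∀ d ∈ D, ∀ d' ∈ D, G.Adj u1 d → G.Adj u1 d' → d ≠ d' → G.Adj d d')
    (c2 : ∀ d ∈ D, ∀ d' ∈ D, G.Adj u2 d → G.Adj u2 d' → d ≠ d' → G.Adj d d')
    (c3 : ∀ d ∈ D, ∀ d' ∈ D, G.Adj u3 d → G.Adj u3 d' → d ≠ d' → G.Adj d d') : False := by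
  have o1 : u1 ∉ D := fun h => hcD _ h a1
  have o2 : u2 ∉ D := fun h => hcD _ h a2
  have o3 : u3 ∉ D := fun h => hcD _ h a3
  obtain ⟨d1, hd1, ad1⟩ := t1
  obtain ⟨d2, hd2, ad2⟩ := t2
  obtain ⟨d3, hd3, ad3⟩ := t3
  -- the path P
  have r12 : RR G (D ∪ {u1, u2}) u1 u2 := by
    have h1 : RR G (D ∪ {u1, u2}) u1 d1 := RR.edge (by simp) (by simp [hd1]) ad1
    exact (h1.trans ((hD d1 hd1 d2 hd2).mono Set.subset_union_left)).tail ad2.symm (by simp)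
  obtain ⟨n, p, pfw, p0, pn, pmin, pip⟩ := shortest (fun x => x = u2) r12 rfl
  have hn2 : 2 ≤ n := by
    by_contra h
    have : n = 0 ∨ n = 1 := by omega
    rcases this with h | h
    · subst h; exact e12 (p0.symm.trans pn)
    · subst h
      have := pip.adj 0 (by omega)
      rw [p0] at this
      simp only [zero_add] at this
      rw [pn] at this
      exact n12 this
  have pD : ∀ i, 0 < i → i < n → p i ∈ D := by
    intro i h0 hi
    rcases pfw.1 i hi.le with h | h | h
    · exact h
    · exact absurd (p0.trans h.symm) (pip.inj 0 i h0 hi.le)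
    · exact absurd h (pmin i hi)
  have cp : ∀ i ≤ n, G.Adj c (p i) → i = 0 ∨ i = n := by
    intro i hi a
    by_contra h
    exact hcD _ (pD i (by omega) (by omega)) a
  have pc : ∀ i ≤ n, p i ≠ c := by
    intro i hi e
    rcases pfw.1 i hi with h | h | h
    · exact hc (e ▸ h)
    · exact a1.ne (e.symm.trans h)
    · exact a2.ne (e.symm.trans h)
  have p3 : ∀ i ≤ n, p i ≠ u3 := by
    intro i hi e
    rcases pfw.1 i hi with h | h | h
    · exact o3 (e ▸ h)
    · exact e13 (h.symm.trans e)
    · exact e23 (h.symm.trans e)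
  -- the path Q
  have r3 : RR G (D ∪ {u3}) u3 (p 1) := by
    have h1 : RR G (D ∪ {u3}) u3 d3 := RR.edge (by simp) (by simp [hd3]) ad3
    exact h1.trans ((hD d3 hd3 _ (pD 1 (by omega) (by omega))).mono Set.subset_union_left)
  obtain ⟨m, q, qfw, q0, ⟨iw, hiw, aiw⟩, qmin, qip⟩ :=
    shortest (fun x => ∃ i ≤ n, G.Adj x (p i)) r3 ⟨0, by omega, by
      have := pip.adj 0 (by omega); exact this.symm⟩
  have pnb : ∀ i ≤ n, ∃ j ≤ n, G.Adj (p i) (p j) := by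
    intro i hi
    by_cases h : i = n
    · refine ⟨n - 1, by omega, ?_⟩
      have := pip.adj (n-1) (by omega)
      rw [show n - 1 + 1 = n by omega] at this
      rw [h]; exact this.symm
    · exact ⟨i+1, by omega, pip.adj i (by omega)⟩
  have qp : ∀ j ≤ m, ∀ i ≤ n, q j ≠ p i := by
    intro j hj i hi e
    by_cases hjm : j = m
    · by_cases hm : m = 0
      · subst hm; subst hjm
        exact p3 i hi (e.symm.trans q0)
      · have := qip.adj (m-1) (by omega)
        rw [show m - 1 + 1 = m by omega] at this
        subst hjm
        rw [e] at this
        exact qmin (j-1) (by omega) ⟨i, hi, this⟩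
    · obtain ⟨k, hk, a⟩ := pnb i hi
      exact qmin j (by omega) ⟨k, hk, e ▸ a⟩
  have qpn : ∀ j < m, ∀ i ≤ n, ¬ G.Adj (q j) (p i) := fun j hj i hi a => qmin j hj ⟨i, hi, a⟩
  have qD : ∀ j, 0 < j → j ≤ m → q j ∈ D := by
    intro j h0 hj
    rcases qfw.1 j hj with h | h
    · exact h
    · exact absurd (q0.trans (Eq.symm h)) (qip.inj 0 j h0 hj)
  have qc : ∀ j ≤ m, q j ≠ c := by
    intro i hi e
    rcases qfw.1 i hi with h | h
    · exact hc (e ▸ h)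
    · exact a3.ne (e.symm.trans h)
  have cq : ∀ j ≤ m, G.Adj c (q j) → j = 0 := by
    intro i hi a
    by_contra h
    exact hcD _ (qD i (by omega) (by omega)) a
  -- min and max index
  have hex : ∃ i, i ≤ n ∧ G.Adj (q m) (p i) := ⟨iw, hiw, aiw⟩
  obtain ⟨lo, ⟨hlo, alo⟩, lomin⟩ : ∃ lo, (lo ≤ n ∧ G.Adj (q m) (p lo)) ∧
      ∀ i ≤ n, G.Adj (q m) (p i) → lo ≤ i :=
    ⟨Nat.find hex, Nat.find_spec hex, fun i hi a => Nat.find_min' hex ⟨hi, a⟩⟩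
  obtain ⟨hi, ⟨hhi, ahi⟩, himax⟩ : ∃ hi, (hi ≤ n ∧ G.Adj (q m) (p hi)) ∧
      ∀ i ≤ n, G.Adj (q m) (p i) → i ≤ hi := by
    have hex' : ∃ k, k ≤ n ∧ G.Adj (q m) (p (n - k)) := ⟨n - iw, by omega, by
      rwa [show n - (n - iw) = iw by omega]⟩
    refine ⟨n - Nat.find hex', ⟨by omega, (Nat.find_spec hex').2⟩, fun i hi a => ?_⟩
    have := Nat.find_min' hex' (m := n - i) ⟨by omega, by rwa [show n - (n - i) = i by omega]⟩
    omega
  have hlohi : lo ≤ hi := lomin hi hhi ahi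
  -- sub-paths from c
  have ac0 : G.Adj c (p 0) := by rw [p0]; exact a1
  have acn : G.Adj c (p n) := by rw [pn]; exact a2
  have acq : G.Adj c (q 0) := by rw [q0]; exact a3
  have rlow : ∀ i ≤ n, ∀ S : Set V, c ∈ S → (∀ k ≤ i, p k ∈ S) → RR G S c (p i) := by
    intro i hi S hcS hS
    exact (RR.edge hcS (hS 0 (by omega)) ac0).trans
      (rr_of_fun 0 i (by omega) (fun k _ h => hS k h) (fun k _ h => pip.adj k (by omega)))
  have rhigh : ∀ i ≤ n, ∀ S : Set V, c ∈ S → (∀ k, i ≤ k → k ≤ n → p k ∈ S) → RR G S c (p i) := by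
    intro i hi S hcS hS
    exact (RR.edge hcS (hS n hi le_rfl) acn).trans
      (rr_of_fun i n hi (fun k h h' => hS k h h') (fun k _ h => pip.adj k (by omega))).symm
  have rq : ∀ j ≤ m, ∀ S : Set V, c ∈ S → (∀ k ≤ j, q k ∈ S) → RR G S c (q j) := by
    intro i hi S hcS hS
    exact (RR.edge hcS (hS 0 (by omega)) acq).trans
      (rr_of_fun 0 i (by omega) (fun k _ h => hS k h) (fun k _ h => qip.adj k (by omega)))
  have pinj : ∀ i ≤ n, ∀ j ≤ n, p i = p j → i = j := by
    intro i hi j hj e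
    rcases lt_trichotomy i j with h | h | h
    · exact absurd e (pip.inj i j h hj)
    · exact h
    · exact absurd e.symm (pip.inj j i h hi)
  have m0 : ∀ i ≤ n, m = 0 → G.Adj (q m) (p i) → 0 < i ∧ i < n := by
    intro i hi hm a
    subst hm
    rw [q0] at a
    constructor
    · by_contra h
      have : i = 0 := by omega
      subst this
      rw [p0] at a; exact n13 a.symm
    · by_contra h
      have : i = n := by omega
      subst this
      rw [pn] at a; exact n23 a.symm
  rcases (show hi = lo ∨ hi = lo + 1 ∨ lo + 2 ≤ hi by omega) with hcase | hcase | hcase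
  · -- single attachment
    subst hcase
    have only : ∀ i ≤ n, G.Adj (q m) (p i) → i = hi :=
      fun i h a => le_antisymm (himax i h a) (lomin i h a)
    have h0 : 0 < hi := by
      by_contra h
      have h0 : hi = 0 := by omega
      have hm : 0 < m := by
        by_contra hm
        have := m0 hi hhi (by omega) ahi
        omega
      rw [h0, p0] at ahi
      have h1 := pip.adj 0 (by omega)
      rw [p0] at h1
      have := c1 _ (qD m hm le_rfl) _ (pD 1 (by omega) (by omega)) ahi.symm h1 (qp _ le_rfl _ (by omega))
      have := only 1 (by omega) this
      omega
    have hnn : hi < n := by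
      by_contra h
      have h0 : hi = n := by omega
      have hm : 0 < m := by
        by_contra hm
        have := m0 hi hhi (by omega) ahi
        omega
      rw [h0, pn] at ahi
      have h1 := pip.adj (n-1) (by omega)
      rw [show n - 1 + 1 = n by omega, pn] at h1
      have := c2 _ (qD m hm le_rfl) _ (pD (n-1) (by omega) (by omega)) ahi.symm h1.symm
        (qp _ le_rfl _ (by omega))
      have := only (n-1) (by omega) this
      omega
    refine theta_of hT (u := c) (w := p hi) (pc _ hhi).symm (hcD _ (pD _ h0 hnn))
      {v | ∃ i < hi, v = p i} {v | ∃ i, hi < i ∧ i ≤ n ∧ v = p i} {v | ∃ j ≤ m, v = q j}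
      ?_ ?_ ?_ ?_ ?_ ?_ ?_ ?_ ?_
    · apply rlow hi hhi _ (by simp)
      intro k hk
      by_cases h : k = hi
      · subst h; simp
      · exact Or.inl ⟨k, by omega, rfl⟩
    · apply rhigh hi hhi _ (by simp)
      intro k hk hk'
      by_cases h : k = hi
      · subst h; simp
      · exact Or.inl ⟨k, by omega, hk', rfl⟩
    · refine (rq m le_rfl _ (by simp) ?_).tail ahi (by simp)
      intro k hk
      exact Or.inl ⟨k, hk, rfl⟩
    · rw [Set.disjoint_left]
      rintro _ ⟨i, hi1, rfl⟩ ⟨j, hj, hj', e⟩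
      exact pip.inj i j (by omega) hj' e
    · rw [Set.disjoint_left]
      rintro _ ⟨i, hi1, rfl⟩ ⟨j, hj, e⟩
      exact qp j hj i (by omega) e.symm
    · rw [Set.disjoint_left]
      rintro _ ⟨i, _, hi1, rfl⟩ ⟨j, hj, e⟩
      exact qp j hj i (by omega) e.symm
    · rintro _ ⟨i, hi1, rfl⟩ _ ⟨j, hj, hj', rfl⟩
      exact pip.nadj i j (by omega) hj'
    · rintro _ ⟨i, hi1, rfl⟩ _ ⟨j, hj, rfl⟩ a
      by_cases h : j = m
      · subst h
        have := only i (by omega) a.symm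
        omega
      · exact qpn j (by omega) i (by omega) a.symm
    · rintro _ ⟨i, hi0, hi1, rfl⟩ _ ⟨j, hj, rfl⟩ a
      by_cases h : j = m
      · subst h
        have := only i (by omega) a.symm
        omega
      · exact qpn j (by omega) i (by omega) a.symm
  · -- triangle
    subst hcase
    have X1 : ∀ u ∈ {v | ∃ i ≤ lo, v = p i}, ∀ v ∈ {v | ∃ i, lo + 1 ≤ i ∧ i ≤ n ∧ v = p i},
        u ≠ v ∧ (G.Adj u v → u = p lo ∧ v = p (lo+1)) := by
      rintro _ ⟨i, hi1, rfl⟩ _ ⟨j, hj, hj', rfl⟩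
      refine ⟨pip.inj i j (by omega) hj', fun a => ?_⟩
      by_cases h : j = i + 1
      · have : i = lo := by omega
        subst this; subst h; exact ⟨rfl, rfl⟩
      · exact absurd a (pip.nadj i j (by omega) hj')
    have X2 : ∀ u ∈ {v | ∃ i ≤ lo, v = p i}, ∀ v ∈ {v | ∃ j ≤ m, v = q j},
        u ≠ v ∧ (G.Adj u v → u = p lo ∧ v = q m) := by
      rintro _ ⟨i, hi1, rfl⟩ _ ⟨j, hj, rfl⟩
      refine ⟨(qp j hj i (by omega)).symm, fun a => ?_⟩
      by_cases h : j = m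
      · subst h
        have := lomin i (by omega) a.symm
        have : i = lo := by omega
        subst this; exact ⟨rfl, rfl⟩
      · exact absurd a.symm (qpn j (by omega) i (by omega))
    have X3 : ∀ u ∈ {v | ∃ i, lo + 1 ≤ i ∧ i ≤ n ∧ v = p i}, ∀ v ∈ {v | ∃ j ≤ m, v = q j},
        u ≠ v ∧ (G.Adj u v → u = p (lo+1) ∧ v = q m) := by
      rintro _ ⟨i, hi1, hi2, rfl⟩ _ ⟨j, hj, rfl⟩
      refine ⟨(qp j hj i (by omega)).symm, fun a => ?_⟩
      by_cases h : j = m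
      · subst h
        have := himax i (by omega) a.symm
        have : i = lo + 1 := by omega
        subst this; exact ⟨rfl, rfl⟩
      · exact absurd a.symm (qpn j (by omega) i (by omega))
    have tri := pip.adj lo (by omega)
    have Y1 : G.Adj c (p lo) → lo = 0 := fun a => by
      have := cp lo hlo a; omega
    have Y2 : G.Adj c (p (lo+1)) → lo + 1 = n := fun a => by
      have := cp (lo+1) hhi a; omega
    have Y3 : G.Adj c (q m) → m = 0 := cq m le_rfl
    exact pyramid_of3 hP c (p lo) (p (lo+1)) (q m) {v | ∃ i ≤ lo, v = p i}
      {v | ∃ i, lo + 1 ≤ i ∧ i ≤ n ∧ v = p i} {v | ∃ j ≤ m, v = q j} tri alo.symm ahi.symm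
      (pc _ hlo).symm (pc _ hhi).symm (qc _ le_rfl).symm
      (rlow lo hlo _ (by simp) (fun k hk => Or.inr ⟨k, hk, rfl⟩))
      (rhigh (lo+1) hhi _ (by simp) (fun k hk hk' => Or.inr ⟨k, hk, hk', rfl⟩))
      (rq m le_rfl _ (by simp) (fun k hk => Or.inr ⟨k, hk, rfl⟩))
      (fun a b => by have := Y1 a; have := Y2 b; omega)
      (fun a b => by have := Y1 a; have := m0 lo hlo (Y3 b) alo; omega)
      (fun a b => by have := Y2 a; have := m0 (lo+1) hhi (Y3 b) ahi; omega)
      X1 X2 X3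
  · -- far attachments
    have hm : 0 < m := by
      by_contra hm
      have hm : m = 0 := by omega
      have h1 := m0 lo hlo hm alo
      have h2 := m0 hi hhi hm ahi
      subst hm
      rw [q0] at alo ahi
      exact pip.nadj lo hi (by omega) hhi
        (c3 _ (pD lo h1.1 h1.2) _ (pD hi h2.1 h2.2) alo ahi (pip.inj lo hi (by omega) hhi))
    refine theta_of hT (u := c) (w := q m) (qc _ le_rfl).symm (hcD _ (qD _ hm le_rfl))
      {v | ∃ i ≤ lo, v = p i} {v | ∃ i, hi ≤ i ∧ i ≤ n ∧ v = p i} {v | ∃ j < m, v = q j}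
      ?_ ?_ ?_ ?_ ?_ ?_ ?_ ?_ ?_
    · refine (rlow lo hlo _ (by simp) ?_).tail alo.symm (by simp)
      exact fun k hk => Or.inl ⟨k, hk, rfl⟩
    · refine (rhigh hi hhi _ (by simp) ?_).tail ahi.symm (by simp)
      exact fun k hk hk' => Or.inl ⟨k, hk, hk', rfl⟩
    · refine rq m le_rfl _ (by simp) ?_
      intro k hk
      by_cases h : k = m
      · subst h; simp
      · exact Or.inl ⟨k, by omega, rfl⟩
    · rw [Set.disjoint_left]
      rintro _ ⟨i, hi1, rfl⟩ ⟨j, hj, hj', e⟩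
      exact pip.inj i j (by omega) hj' e
    · rw [Set.disjoint_left]
      rintro _ ⟨i, hi1, rfl⟩ ⟨j, hj, e⟩
      exact qp j hj.le i (by omega) e.symm
    · rw [Set.disjoint_left]
      rintro _ ⟨i, _, hi1, rfl⟩ ⟨j, hj, e⟩
      exact qp j hj.le i (by omega) e.symm
    · rintro _ ⟨i, hi1, rfl⟩ _ ⟨j, hj, hj', rfl⟩
      exact pip.nadj i j (by omega) hj'
    · rintro _ ⟨i, hi1, rfl⟩ _ ⟨j, hj, rfl⟩ a
      exact qpn j (by omega) i (by omega) a.symm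
    · rintro _ ⟨i, hi0, hi1, rfl⟩ _ ⟨j, hj, rfl⟩ a
      exact qpn j (by omega) i (by omega) a.symm

end Sep

open SimpleGraph

namespace Sep
open Classical

variable {V : Type*} {G : SimpleGraph V}

theorem ramsey (G : SimpleGraph V) (k : ℕ) : ∀ (w : ℕ) (S : Finset V),
    (∀ C ⊆ S, G.IsClique (C : Set V) → C.card ≤ w) →
    (∀ I ⊆ S, Paper.IsIndep G (I : Set V) → I.card ≤ k) → S.card ≤ (w + 1) ^ k := by
  induction k with
  | zero =>
    intro w S _ h
    by_contra hS
    have : 0 < S.card := by simp at hS; omega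
    obtain ⟨x, hx⟩ := Finset.card_pos.1 this
    have := h {x} (by simpa using hx) (by
      intro a ha b hb hab
      simp at ha hb
      exact absurd (ha.trans hb.symm) hab)
    simp at this
  | succ k ihk =>
    intro w
    induction w with
    | zero =>
      intro S h _
      rcases S.eq_empty_or_nonempty with rfl | ⟨x, hx⟩
      · simp
      · have := h {x} (by simpa using hx) (by simp)
        simp at this
    | succ w ihw =>
      intro S h1 h2
      rcases S.eq_empty_or_nonempty with rfl | ⟨x, hx⟩
      · simp
      have hN := ihw (S.filter (fun y => G.Adj x y)) (by
        intro C hC hcl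
        have hx' : x ∉ C := fun h => by
          have := hC h; simp at this
        have := h1 (insert x C) (by
          intro y hy
          rcases Finset.mem_insert.1 hy with rfl | hy
          · exact hx
          · exact (Finset.mem_filter.1 (hC hy)).1) (by
          rw [Finset.coe_insert]
          apply hcl.insert
          intro b hb _
          exact (Finset.mem_filter.1 (hC hb)).2)
        rw [Finset.card_insert_of_notMem hx'] at this
        omega) (fun I hI => h2 I (hI.trans (Finset.filter_subset _ _)))
      have hM := ihk (w+1) (S.filter (fun y => ¬ G.Adj x y ∧ y ≠ x))
        (fun C hC => h1 C (hC.trans (Finset.filter_subset _ _))) (by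
        intro I hI hin
        have hx' : x ∉ I := fun h => by
          have := hI h; simp at this
        have := h2 (insert x I) (by
          intro y hy
          rcases Finset.mem_insert.1 hy with rfl | hy
          · exact hx
          · exact (Finset.mem_filter.1 (hI hy)).1) (by
          intro a ha b hb hab
          simp only [Finset.coe_insert, Set.mem_insert_iff] at ha hb
          rcases ha with rfl | ha <;> rcases hb with rfl | hb
          · exact absurd rfl hab
          · exact (Finset.mem_filter.1 (hI hb)).2.1
          · exact fun h => (Finset.mem_filter.1 (hI ha)).2.1 h.symm
          · exact hin ha hb hab)
        rw [Finset.card_insert_of_notMem hx'] at this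
        omega)
      have hS : S ⊆ insert x (S.filter (fun y => G.Adj x y) ∪ S.filter (fun y => ¬ G.Adj x y ∧ y ≠ x)) := by
        intro y hy
        simp only [Finset.mem_insert, Finset.mem_union, Finset.mem_filter]
        tauto
      have h3 := Finset.card_le_card hS
      have h4 := Finset.card_insert_le x (S.filter (fun y => G.Adj x y) ∪ S.filter (fun y => ¬ G.Adj x y ∧ y ≠ x))
      have h5 := Finset.card_union_le (S.filter (fun y => G.Adj x y)) (S.filter (fun y => ¬ G.Adj x y ∧ y ≠ x))
      have h6 : (w+1)^k + 1 ≤ (w+1+1)^k ∨ k = 0 := by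
        rcases Nat.eq_zero_or_pos k with h | h
        · exact Or.inr h
        · left
          exact Nat.pow_lt_pow_left (by omega) (by omega)
      rcases h6 with h6 | h6
      · have h7 : (w+1+1)^(k+1) = (w+1)*(w+1+1)^k + (w+1+1)^k := by ring
        have h8 : (w+1)^(k+1) = (w+1)*(w+1)^k := by ring
        have h9 := Nat.mul_le_mul_left (w+1) h6
        rw [mul_add, mul_one] at h9
        omega
      · subst h6
        -- no nonadjacent pairs: S is a clique
        have := h1 S le_rfl (by
          intro a ha b hb hab
          by_contra hn
          have := h2 {a, b} (by
            intro y hy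
            simp at hy
            rcases hy with rfl | rfl <;> assumption) (by
            intro c hc d hd hcd
            simp at hc hd
            rcases hc with rfl | rfl <;> rcases hd with rfl | rfl
            · exact absurd rfl hcd
            · exact hn
            · exact fun h => hn h.symm
            · exact absurd rfl hcd)
          rw [Finset.card_pair hab] at this
          omega)
        simp
        omega

/-- the number `r` -/
noncomputable def rr (G : SimpleGraph V) : ℕ := (G.cliqueNum + 1) ^ 2

theorem w_le_rr : G.cliqueNum ≤ rr G := by
  unfold rr
  nlinarith

theorem clique_le [Fintype V] {C : Finset V} (h : G.IsClique (C : Set V)) : C.card ≤ G.cliqueNum :=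
  h.card_le_cliqueNum

theorem indep_exists [Fintype V] (k : ℕ) (S : Finset V) (h : (G.cliqueNum + 1) ^ k < S.card) :
    ∃ I ⊆ S, Paper.IsIndep G (I : Set V) ∧ k + 1 ≤ I.card := by
  by_contra hcon
  push Not at hcon
  have := ramsey G k G.cliqueNum S (fun C _ hC => clique_le hC) (fun I h1 h2 => by
    have := hcon I h1 h2; omega)
  omega

/-- independent triple -/
def Tri (G : SimpleGraph V) (a b c : V) : Prop :=
  a ≠ b ∧ a ≠ c ∧ b ≠ c ∧ ¬ G.Adj a b ∧ ¬ G.Adj a c ∧ ¬ G.Adj b c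

theorem tri_exists [Fintype V] (S : Finset V) (h : rr G < S.card) :
    ∃ a ∈ S, ∃ b ∈ S, ∃ c ∈ S, Tri G a b c := by
  obtain ⟨I, h1, h2, h3⟩ := indep_exists 2 S h
  obtain ⟨a, b, c, ha, hb, hc, hab, hac, hbc⟩ := Finset.two_lt_card_iff.1 (show 2 < I.card by omega)
  exact ⟨a, h1 ha, b, h1 hb, c, h1 hc, hab, hac, hbc, h2 ha hb hab, h2 ha hc hac, h2 hb hc hbc⟩

theorem pair_exists [Fintype V] (S : Finset V) (h : G.cliqueNum < S.card) :
    ∃ a ∈ S, ∃ b ∈ S, a ≠ b ∧ ¬ G.Adj a b := by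
  by_contra hcon
  push Not at hcon
  have : G.IsClique (S : Set V) := fun a ha b hb hab => hcon a ha b hb hab
  have := clique_le this
  omega

theorem k23 (hT : Paper.ThetaFree G) {f f' a b c : V} (hf : f ≠ f') (hn : ¬ G.Adj f f')
    (ht : Tri G a b c) (fa : G.Adj f a) (fb : G.Adj f b) (fc : G.Adj f c)
    (fa' : G.Adj f' a) (fb' : G.Adj f' b) (fc' : G.Adj f' c) : False := by
  obtain ⟨h1, h2, h3, h4, h5, h6⟩ := ht
  have key : ∀ x, G.Adj f x → G.Adj f' x → RR G ({x} ∪ {f, f'}) f f' := fun x h h' =>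
    (RR.edge (by simp) (by simp) h).tail h'.symm (by simp)
  refine theta_of hT hf hn {a} {b} {c} (key a fa fa') (key b fb fb') (key c fc fc')
    (by simpa using h1) (by simpa using h2) (by simpa using h3) ?_ ?_ ?_
  · rintro _ rfl _ rfl; exact h4
  · rintro _ rfl _ rfl; exact h5
  · rintro _ rfl _ rfl; exact h6

theorem common_le [Fintype V] (hT : Paper.ThetaFree G) {f f' : V} (hf : f ≠ f') (hn : ¬ G.Adj f f')
    (S : Finset V) (hS : ∀ s ∈ S, G.Adj f s ∧ G.Adj f' s) : S.card ≤ rr G := by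
  by_contra h
  obtain ⟨a, ha, b, hb, c, hc, ht⟩ := tri_exists (G := G) S (by omega)
  exact k23 hT hf hn ht (hS a ha).1 (hS b hb).1 (hS c hc).1 (hS a ha).2 (hS b hb).2 (hS c hc).2

def Link (G : SimpleGraph V) (x x' : V) (F : Set V) : Prop :=
  ∃ (u : V) (A : Set V), G.Adj x u ∧ Conn G A ∧ x' ∈ A ∧ x ∉ A ∧ (∀ y ∈ A, ¬ G.Adj x y) ∧
    (∃ y ∈ A, G.Adj u y) ∧ (∀ y ∈ A, ∀ y' ∈ A, G.Adj u y → G.Adj u y' → y ≠ y' → G.Adj y y') ∧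
    u ∉ F ∧ (∀ f ∈ F, ¬ G.Adj u f) ∧ ∀ y ∈ A, y ≠ x' → ∀ f ∈ F, ¬ G.Adj y f

structure Inst (G : SimpleGraph V) (K B : Set V) (b0 : V) (T X : Finset V) : Prop where
  cK : Conn G K
  cB : Conn G B
  BK : B ⊆ K
  bB : b0 ∈ B
  TB : ∀ t ∈ T, ∀ y ∈ B, ¬ G.Adj t y
  X2 : X.card ≤ 2
  XK : ∀ x ∈ X, x ∉ K
  XK' : ∀ x ∈ X, ∀ y ∈ K, ¬ G.Adj x y
  TX : ∀ t ∈ T, ∃ x ∈ X, G.Adj x t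
  one : ∀ x ∈ X, ∀ x' ∈ X, x ≠ x' → ∀ t ∈ T, G.Adj x t → ¬ G.Adj x' t
  link : ∀ x ∈ X, ∀ x' ∈ X, x ≠ x' → Link G x x' (↑T ∪ K)

theorem Link.mono {x x' : V} {F F' : Set V} (h : Link G x x' F) (hF : F' ⊆ F) : Link G x x' F' := by
  obtain ⟨u, A, h1, h2, h3, h4, h5, h6, h7, h8, h9, h10⟩ := h
  exact ⟨u, A, h1, h2, h3, h4, h5, h6, h7, fun h => h8 (hF h), fun f hf => h9 f (hF hf),
    fun y hy hyx f hf => h10 y hy hyx f (hF hf)⟩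

theorem Inst.mono {K B K' B' : Set V} {b0 : V} {T T' X : Finset V} (I : Inst G K B b0 T X)
    (hK : K' ⊆ K) (cK : Conn G K') (cB : Conn G B') (BK : B' ⊆ K') (bB : b0 ∈ B') (hT : T' ⊆ T)
    (TB : ∀ t ∈ T', ∀ y ∈ B', ¬ G.Adj t y) : Inst G K' B' b0 T' X where
  cK := cK
  cB := cB
  BK := BK
  bB := bB
  TB := TB
  X2 := I.X2
  XK := fun x hx h => I.XK x hx (hK h)
  XK' := fun x hx y hy => I.XK' x hx y (hK hy)
  TX := fun t ht => I.TX t (hT ht)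
  one := fun x hx x' hx' h t ht => I.one x hx x' hx' h t (hT ht)
  link := fun x hx x' hx' h => (I.link x hx x' hx' h).mono
    (Set.union_subset_union (by exact_mod_cast hT) hK)

theorem Inst.TK {K B : Set V} {b0 : V} {T X : Finset V} (I : Inst G K B b0 T X) {t : V} (ht : t ∈ T) :
    t ∉ K := by
  intro h
  obtain ⟨x, hx, a⟩ := I.TX t ht
  exact I.XK' x hx t h a

/-- core of TC: two terminals at the same root -/
theorem Inst.coreA (hT : Paper.ThetaFree G) (hP : Paper.PyramidFree G)
    {K B : Set V} {b0 : V} {T X : Finset V} (I : Inst G K B b0 T X) {t1 t2 t3 x x' : V}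
    (h1 : t1 ∈ T) (h2 : t2 ∈ T) (h3 : t3 ∈ T) (tri : Tri G t1 t2 t3)
    (hx : x ∈ X) (hx' : x' ∈ X) (a1 : G.Adj x t1) (a2 : G.Adj x t2) (a3 : G.Adj x' t3)
    {D : Set V} (hD : Conn G D) (hDK : D ⊆ K)
    (e1 : ∃ d ∈ D, G.Adj t1 d) (e2 : ∃ d ∈ D, G.Adj t2 d) (e3 : ∃ d ∈ D, G.Adj t3 d)
    (c1 : ∀ d ∈ D, ∀ d' ∈ D, G.Adj t1 d → G.Adj t1 d' → d ≠ d' → G.Adj d d')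
    (c2 : ∀ d ∈ D, ∀ d' ∈ D, G.Adj t2 d → G.Adj t2 d' → d ≠ d' → G.Adj d d')
    (c3 : ∀ d ∈ D, ∀ d' ∈ D, G.Adj t3 d → G.Adj t3 d' → d ≠ d' → G.Adj d d') : False := by
  obtain ⟨n12, n13, n23, m12, m13, m23⟩ := tri
  by_cases hxx : x = x'
  · subst hxx
    exact lemmaA hT hP a1 a2 a3 n12 n13 n23 m12 m13 m23 hD (fun h => I.XK x hx (hDK h))
      (fun d hd => I.XK' x hx d (hDK hd)) e1 e2 e3 c1 c2 c3
  obtain ⟨u, A, l1, l2, l3, l4, l5, l6, l7, l8, l9, l10⟩ := I.link x hx x' hx' hxx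
  have l9T : ∀ t ∈ T, ¬ G.Adj u t := fun t ht => l9 t (Or.inl ht)
  have l9K : ∀ t ∈ K, ¬ G.Adj u t := fun t ht => l9 t (Or.inr ht)
  have hxx' : ¬ G.Adj x x' := l5 _ l3
  obtain ⟨d1, hd1, ad1⟩ := e1
  obtain ⟨d2, hd2, ad2⟩ := e2
  obtain ⟨d3, hd3, ad3⟩ := e3
  obtain ⟨y0, hy0, ay0⟩ := l6
  -- t1, t2 see no vertex of A or t3
  have tA : ∀ t ∈ T, G.Adj x t → ∀ y ∈ A, ¬ G.Adj t y := by
    intro t ht a y hy a'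
    by_cases e : y = x'
    · subst e; exact I.one x hx y hx' hxx t ht a a'.symm
    · exact l10 y hy e t (Or.inl ht) a'.symm
  have hD' : Conn G (insert t3 D ∪ A) :=
    conn_union_adj (conn_insert hD hd3 ad3.symm) l2 (Set.mem_insert _ _) l3 a3.symm
  have red : ∀ t ∈ T, G.Adj x t → ¬ G.Adj t t3 → ∀ d ∈ insert t3 D ∪ A, G.Adj t d → d ∈ D := by
    rintro t ht a hn d ((rfl | hd) | hd) a'
    · exact absurd a' hn
    · exact hd
    · exact absurd a' (tA t ht a d hd)
  have redu : ∀ d ∈ insert t3 D ∪ A, G.Adj u d → d ∈ A := by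
    rintro d ((rfl | hd) | hd) a'
    · exact absurd a' (l9T _ h3)
    · exact absurd a' (l9K _ (hDK hd))
    · exact hd
  refine lemmaA hT hP a1 a2 l1 n12 ?_ ?_ m12 ?_ ?_ hD' ?_ ?_
    ⟨d1, Or.inl (Or.inr hd1), ad1⟩ ⟨d2, Or.inl (Or.inr hd2), ad2⟩ ⟨y0, Or.inr hy0, ay0⟩ ?_ ?_ ?_
  · rintro rfl; exact l9K _ (hDK hd1) ad1
  · rintro rfl; exact l9K _ (hDK hd2) ad2
  · exact fun h => l9T _ h1 h.symm
  · exact fun h => l9T _ h2 h.symm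
  · rintro ((rfl | hd) | hd)
    · exact hxx' a3.symm
    · exact I.XK x hx (hDK hd)
    · exact l4 hd
  · rintro d ((rfl | hd) | hd) a
    · exact I.one x hx x' hx' hxx d h3 a a3
    · exact I.XK' x hx d (hDK hd) a
    · exact l5 d hd a
  · intro d hd d' hd' a a'
    exact c1 d (red _ h1 a1 m13 d hd a) d' (red _ h1 a1 m13 d' hd' a') a a'
  · intro d hd d' hd' a a'
    exact c2 d (red _ h2 a2 m23 d hd a) d' (red _ h2 a2 m23 d' hd' a') a a'
  · intro d hd d' hd' a a'
    exact l7 d (redu d hd a) d' (redu d' hd' a') a a'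

theorem Tri.rot {a b c : V} (h : Tri G a b c) : Tri G b c a := by
  obtain ⟨h1, h2, h3, h4, h5, h6⟩ := h
  exact ⟨h3, h1.symm, h2.symm, h6, fun a => h4 a.symm, fun a => h5 a.symm⟩

theorem Inst.core (hT : Paper.ThetaFree G) (hP : Paper.PyramidFree G)
    {K B : Set V} {b0 : V} {T X : Finset V} (I : Inst G K B b0 T X) {t1 t2 t3 : V}
    (h1 : t1 ∈ T) (h2 : t2 ∈ T) (h3 : t3 ∈ T) (tri : Tri G t1 t2 t3)
    {D : Set V} (hD : Conn G D) (hDK : D ⊆ K)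
    (e1 : ∃ d ∈ D, G.Adj t1 d) (e2 : ∃ d ∈ D, G.Adj t2 d) (e3 : ∃ d ∈ D, G.Adj t3 d)
    (c1 : ∀ d ∈ D, ∀ d' ∈ D, G.Adj t1 d → G.Adj t1 d' → d ≠ d' → G.Adj d d')
    (c2 : ∀ d ∈ D, ∀ d' ∈ D, G.Adj t2 d → G.Adj t2 d' → d ≠ d' → G.Adj d d')
    (c3 : ∀ d ∈ D, ∀ d' ∈ D, G.Adj t3 d → G.Adj t3 d' → d ≠ d' → G.Adj d d') : False := by
  obtain ⟨x1, hx1, a1⟩ := I.TX t1 h1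
  obtain ⟨x2, hx2, a2⟩ := I.TX t2 h2
  obtain ⟨x3, hx3, a3⟩ := I.TX t3 h3
  by_cases e12 : x1 = x2
  · subst e12
    exact I.coreA hT hP h1 h2 h3 tri hx1 hx3 a1 a2 a3 hD hDK e1 e2 e3 c1 c2 c3
  by_cases e23 : x2 = x3
  · subst e23
    exact I.coreA hT hP h2 h3 h1 tri.rot hx2 hx1 a2 a3 a1 hD hDK e2 e3 e1 c2 c3 c1
  by_cases e13 : x1 = x3
  · subst e13
    exact I.coreA hT hP h3 h1 h2 tri.rot.rot hx1 hx2 a3 a1 a2 hD hDK e3 e1 e2 c3 c1 c2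
  have : 2 < X.card := Finset.two_lt_card_iff.2 ⟨x1, x2, x3, hx1, hx2, hx3, e12, e13, e23⟩
  have := I.X2
  omega

theorem Inst.deg [Fintype V] (hT : Paper.ThetaFree G)
    {K B : Set V} {b0 : V} {T X : Finset V} (I : Inst G K B b0 T X) {d : V} (hd : d ∈ K) :
    (T.filter (fun t => G.Adj d t)).card ≤ 2 * rr G := by
  have h1 : T.filter (fun t => G.Adj d t) ⊆
      X.biUnion (fun x => T.filter (fun t => G.Adj d t ∧ G.Adj x t)) := by
    intro t ht
    rw [Finset.mem_filter] at ht
    obtain ⟨x, hx, a⟩ := I.TX t ht.1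
    exact Finset.mem_biUnion.2 ⟨x, hx, Finset.mem_filter.2 ⟨ht.1, ht.2, a⟩⟩
  calc _ ≤ _ := Finset.card_le_card h1
    _ ≤ X.card * rr G := Finset.card_biUnion_le_card_mul _ _ _ (fun x hx => by
        refine common_le hT (f := d) (f' := x) ?_ ?_ _ ?_
        · rintro rfl; exact I.XK _ hx hd
        · exact fun h => I.XK' x hx d hd h.symm
        · intro s hs; exact (Finset.mem_filter.1 hs).2)
    _ ≤ _ := Nat.mul_le_mul_right _ I.X2

/-- independent version of deg -/
theorem Inst.deg' [Fintype V] (hT : Paper.ThetaFree G)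
    {K B : Set V} {b0 : V} {T X : Finset V} (I : Inst G K B b0 T X) {d : V} (hd : d ∈ K)
    (J : Finset V) (hJ : J ⊆ T) (hi : Paper.IsIndep G (J : Set V)) :
    (J.filter (fun t => G.Adj d t)).card ≤ 4 := by
  have h1 : J.filter (fun t => G.Adj d t) ⊆
      X.biUnion (fun x => J.filter (fun t => G.Adj d t ∧ G.Adj x t)) := by
    intro t ht
    rw [Finset.mem_filter] at ht
    obtain ⟨x, hx, a⟩ := I.TX t (hJ ht.1)
    exact Finset.mem_biUnion.2 ⟨x, hx, Finset.mem_filter.2 ⟨ht.1, ht.2, a⟩⟩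
  calc _ ≤ _ := Finset.card_le_card h1
    _ ≤ X.card * 2 := Finset.card_biUnion_le_card_mul _ _ _ (fun x hx => by
        by_contra hlt
        obtain ⟨a, b, c, ha, hb, hc, hab, hac, hbc⟩ := Finset.two_lt_card_iff.1 (not_le.1 hlt)
        rw [Finset.mem_filter] at ha hb hc
        refine k23 hT (f := d) (f' := x) ?_ ?_
          (⟨hab, hac, hbc, hi ha.1 hb.1 hab, hi ha.1 hc.1 hac, hi hb.1 hc.1 hbc⟩ : Tri G a b c)
          ha.2.1 hb.2.1 hc.2.1 ha.2.2 hb.2.2 hc.2.2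
        · rintro rfl; exact I.XK _ hx hd
        · exact fun h => I.XK' x hx d hd h.symm)
    _ ≤ _ := Nat.mul_le_mul_right 2 I.X2

end Sep

open SimpleGraph

namespace Sep
open Classical

variable {V : Type*} {G : SimpleGraph V}

def KS (G : SimpleGraph V) (K : Set V) (b0 : V) (S : Set V) : Set V :=
  comp G {v | v ∈ K ∧ ∀ s ∈ S, ¬ G.Adj s v} b0

def esc (G : SimpleGraph V) (K : Set V) (b0 : V) (t : V) (S : Set V) : Prop :=
  ∃ v ∈ KS G K b0 S, G.Adj t v

variable {K B : Set V} {b0 : V} {T X : Finset V}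

theorem KS_sub {S : Set V} : KS G K b0 S ⊆ K := fun _ hv => (comp_sub hv).1

theorem KS_n {S : Set V} {v s : V} (hv : v ∈ KS G K b0 S) (hs : s ∈ S) : ¬ G.Adj s v :=
  (comp_sub hv).2 s hs

theorem esc_self {S : Set V} {s : V} (hs : s ∈ S) : ¬ esc G K b0 s S := by
  rintro ⟨v, hv, a⟩
  exact KS_n hv hs a

theorem KS_anti {S W : Set V} (h : ∀ s ∈ S, ¬ esc G K b0 s W) : KS G K b0 W ⊆ KS G K b0 S :=
  comp_sub_of (fun v hv => ⟨KS_sub hv, fun s hs a => h s hs ⟨v, hv, a⟩⟩)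

theorem esc_mono {S W : Set V} {t : V} (h : ∀ s ∈ S, ¬ esc G K b0 s W) (ht : esc G K b0 t W) :
    esc G K b0 t S := by
  obtain ⟨v, hv, a⟩ := ht
  exact ⟨v, KS_anti h hv, a⟩

theorem esc_path {S : Set V} {t : V} (h : esc G K b0 t S) :
    ∃ D : Set V, Conn G D ∧ b0 ∈ D ∧ D ⊆ K ∧ (∀ s ∈ S, ∀ d ∈ D, ¬ G.Adj s d) ∧
      ∃ d ∈ D, G.Adj t d ∧ ∀ d' ∈ D, G.Adj t d' → d' = d := by
  obtain ⟨v, hv, a⟩ := h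
  obtain ⟨n, p, h1, h2, h3, h4, h5⟩ := shortest (fun x => G.Adj t x) hv a
  refine ⟨{v | ∃ i ≤ n, v = p i}, conn_of_fun n h5.adj, ⟨0, by omega, h2.symm⟩, ?_, ?_,
    p n, ⟨n, le_rfl, rfl⟩, h3, ?_⟩
  · rintro _ ⟨i, hi, rfl⟩; exact (h1.1 i hi).1
  · rintro s hs _ ⟨i, hi, rfl⟩; exact (h1.1 i hi).2 s hs
  · rintro _ ⟨i, hi, rfl⟩ a
    by_cases e : i = n
    · rw [e]
    · exact absurd a (h4 i (by omega))

theorem Inst.TC (hT : Paper.ThetaFree G) (hP : Paper.PyramidFree G) (I : Inst G K B b0 T X)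
    {t1 t2 t3 : V} (h1 : t1 ∈ T) (h2 : t2 ∈ T) (h3 : t3 ∈ T) (tri : Tri G t1 t2 t3)
    (s1 : esc G K b0 t1 {t2, t3}) (s2 : esc G K b0 t2 {t1, t3}) (s3 : esc G K b0 t3 {t1, t2}) :
    False := by
  obtain ⟨D1, c1, b1, k1, n1, d1, hd1, a1, u1⟩ := esc_path s1
  obtain ⟨D2, c2, b2, k2, n2, d2, hd2, a2, u2⟩ := esc_path s2
  obtain ⟨D3, c3, b3, k3, n3, d3, hd3, a3, u3⟩ := esc_path s3
  have v1 : ∀ d ∈ D1 ∪ D2 ∪ D3, G.Adj t1 d → d = d1 := by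
    rintro d ((hd | hd) | hd) a
    · exact u1 d hd a
    · exact absurd a (n2 t1 (by simp) d hd)
    · exact absurd a (n3 t1 (by simp) d hd)
  have v2 : ∀ d ∈ D1 ∪ D2 ∪ D3, G.Adj t2 d → d = d2 := by
    rintro d ((hd | hd) | hd) a
    · exact absurd a (n1 t2 (by simp) d hd)
    · exact u2 d hd a
    · exact absurd a (n3 t2 (by simp) d hd)
  have v3 : ∀ d ∈ D1 ∪ D2 ∪ D3, G.Adj t3 d → d = d3 := by
    rintro d ((hd | hd) | hd) a
    · exact absurd a (n1 t3 (by simp) d hd)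
    · exact absurd a (n2 t3 (by simp) d hd)
    · exact u3 d hd a
  exact I.core hT hP h1 h2 h3 tri (D := D1 ∪ D2 ∪ D3)
    (conn_union (conn_union c1 c2 b1 b2) c3 (Or.inl b1) b3)
    (Set.union_subset (Set.union_subset k1 k2) k3)
    ⟨d1, Or.inl (Or.inl hd1), a1⟩ ⟨d2, Or.inl (Or.inr hd2), a2⟩ ⟨d3, Or.inr hd3, a3⟩
    (fun d hd d' hd' a a' hne => absurd ((v1 d hd a).trans (v1 d' hd' a').symm) hne)
    (fun d hd d' hd' a a' hne => absurd ((v2 d hd a).trans (v2 d' hd' a').symm) hne)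
    (fun d hd d' hd' a a' hne => absurd ((v3 d hd a).trans (v3 d' hd' a').symm) hne)

theorem Inst.toolAux [Fintype V] (hT : Paper.ThetaFree G) (hP : Paper.PyramidFree G)
    (I : Inst G K B b0 T X) {p : V} (hp : p ∈ T) (Y : Finset V) (hY : Y ⊆ T)
    (hYp : ∀ y ∈ Y, p ≠ y ∧ ¬ G.Adj p y)
    (hE : ∀ f ∈ Y, ∀ g ∈ Y, f ≠ g → ¬ G.Adj f g → esc G K b0 p {f, g}) (k : ℕ) :
    ∀ S ⊆ Y, (∀ C ⊆ S, G.IsClique (C : Set V) → C.card ≤ k) → ¬ G.IsClique (S : Set V) →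
    ∃ t ∈ S, ∃ t' ∈ S, t ≠ t' ∧ ¬ G.Adj t t' ∧ KS G K b0 {p, t} ⊆ KS G K b0 {p, t'} ∧
      (S.filter (fun u => esc G K b0 u {p, t})).card ≤
        k * (G.cliqueNum + rr G) + 2 * G.cliqueNum := by
  -- basic facts
  have sub : ∀ u v, ¬ esc G K b0 u {p, v} → KS G K b0 {p, v} ⊆ KS G K b0 {p, u} := by
    intro u v h
    apply KS_anti
    rintro s (rfl | rfl)
    · exact esc_self (by simp)
    · exact h
  have nomut : ∀ u ∈ Y, ∀ v ∈ Y, u ≠ v → ¬ G.Adj u v → esc G K b0 u {p, v} →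
      esc G K b0 v {p, u} → False := by
    intro u hu v hv hne hn h1 h2
    exact I.TC hT hP hp (hY hu) (hY hv)
      ⟨(hYp u hu).1, (hYp v hv).1, hne, (hYp u hu).2, (hYp v hv).2, hn⟩ (hE u hu v hv hne hn) h1 h2
  have nself : ∀ u, ¬ esc G K b0 u {p, u} := fun u => esc_self (by simp)
  induction k with
  | zero =>
    intro S _ h1 h2
    exfalso
    apply h2
    intro a ha
    have := h1 {a} (by simpa using ha) (by simp)
    simp at this
  | succ k ih =>
    intro S hS h1 h2
    set J := S.filter (fun s => ∃ s' ∈ S, s ≠ s' ∧ ¬ G.Adj s s') with hJ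
    have hJS : J ⊆ S := Finset.filter_subset _ _
    have hSJ : (S \ J).card ≤ G.cliqueNum := by
      apply clique_le
      intro a ha b hb hab
      by_contra hn
      have ha' := Finset.mem_sdiff.1 (Finset.mem_coe.1 ha)
      have hb' := Finset.mem_sdiff.1 (Finset.mem_coe.1 hb)
      exact ha'.2 (Finset.mem_filter.2 ⟨ha'.1, b, hb'.1, hab, hn⟩)
    have hJne : J.Nonempty := by
      by_contra hne
      rw [Finset.not_nonempty_iff_eq_empty] at hne
      apply h2
      intro a ha b hb hab
      by_contra hn
      have : a ∈ J := Finset.mem_filter.2 ⟨ha, b, hb, hab, hn⟩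
      simp [hne] at this
    obtain ⟨f, hfJ, hmin⟩ := Finset.exists_min_image J (fun f => (KS G K b0 {p, f}).ncard) hJne
    -- minimality: K_{pu} ⊆ K_{pf} gives equality
    have eqm : ∀ u ∈ J, KS G K b0 {p, u} ⊆ KS G K b0 {p, f} →
        KS G K b0 {p, u} = KS G K b0 {p, f} := by
      intro u hu h
      exact Set.eq_of_subset_of_ncard_le h (hmin u hu) (Set.toFinite _)
    have hfS := hJS hfJ
    set S' := J.filter (fun u => esc G K b0 u {p, f}) with hS'
    have hS'J : S' ⊆ J := Finset.filter_subset _ _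
    have hS'f : ∀ u ∈ S', G.Adj f u := by
      intro u hu
      obtain ⟨huJ, hue⟩ := Finset.mem_filter.1 hu
      by_contra hn
      have hne : u ≠ f := by rintro rfl; exact nself _ hue
      by_cases hfu : esc G K b0 f {p, u}
      · exact nomut u (hS (hJS huJ)) f (hS hfS) hne (fun h => hn h.symm) hue hfu
      · have := eqm u huJ (sub f u hfu)
        obtain ⟨v, hv, a⟩ := hue
        exact nself u ⟨v, this ▸ hv, a⟩
    by_cases hcl : G.IsClique (S' : Set V)
    · obtain ⟨_, f', hf'S, hne, hn⟩ := Finset.mem_filter.1 hfJ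
      have hf'J : f' ∈ J := Finset.mem_filter.2 ⟨hf'S, f, hfS, hne.symm, fun h => hn h.symm⟩
      refine ⟨f, hfS, f', hf'S, hne, hn, ?_, ?_⟩
      · apply sub
        intro h
        exact hn (hS'f f' (Finset.mem_filter.2 ⟨hf'J, h⟩))
      · have : S.filter (fun u => esc G K b0 u {p, f}) ⊆ (S \ J) ∪ S' := by
          intro u hu
          rw [Finset.mem_filter] at hu
          by_cases hJu : u ∈ J
          · exact Finset.mem_union_right _ (Finset.mem_filter.2 ⟨hJu, hu.2⟩)
          · exact Finset.mem_union_left _ (Finset.mem_sdiff.2 ⟨hu.1, hJu⟩)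
        have h3 := Finset.card_le_card this
        have h4 := Finset.card_union_le (S \ J) S'
        have h5 := clique_le hcl
        omega
    · obtain ⟨t, ht, t', ht', hne, hn, hsub, hcard⟩ := ih S' (hS'J.trans (hJS.trans hS)) (by
        intro C hC hcl
        have hf : f ∉ C := fun h => (hS'f f (hC h)).ne rfl
        have := h1 (insert f C) (by
          intro y hy
          rcases Finset.mem_insert.1 hy with rfl | hy
          · exact hfS
          · exact hJS (hS'J (hC hy))) (by
          rw [Finset.coe_insert]
          apply hcl.insert
          intro b hb _
          exact hS'f b (hC hb))
        rw [Finset.card_insert_of_notMem hf] at this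
        omega) hcl
      refine ⟨t, hJS (hS'J ht), t', hJS (hS'J ht'), hne, hn, hsub, ?_⟩
      set Gs := (J \ S').filter (fun g => esc G K b0 g {p, t}) with hGs
      have hGc : Gs.card ≤ rr G := by
        refine common_le hT hne hn Gs ?_
        intro g hg
        obtain ⟨hg1, hg2⟩ := Finset.mem_filter.1 hg
        obtain ⟨hgJ, hgS'⟩ := Finset.mem_sdiff.1 hg1
        have hgf : ¬ esc G K b0 g {p, f} := fun h => hgS' (Finset.mem_filter.2 ⟨hgJ, h⟩)
        have hsubg := sub g f hgf
        have hg2' : esc G K b0 g {p, t'} := by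
          obtain ⟨v, hv, a⟩ := hg2
          exact ⟨v, hsub hv, a⟩
        have mk : ∀ s ∈ S', esc G K b0 g {p, s} → G.Adj s g := by
          intro s hs hgs
          have hsf := (Finset.mem_filter.1 hs).2
          have hsg : esc G K b0 s {p, g} := by
            obtain ⟨v, hv, a⟩ := hsf
            exact ⟨v, hsubg hv, a⟩
          by_contra hn
          have hne : s ≠ g := by rintro rfl; exact nself _ hsg
          exact nomut s (hS (hJS (hS'J hs))) g (hS (hJS hgJ)) hne hn hsg hgs
        exact ⟨mk t ht hg2, mk t' ht' hg2'⟩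
      have : S.filter (fun u => esc G K b0 u {p, t}) ⊆
          (S \ J) ∪ (S'.filter (fun u => esc G K b0 u {p, t}) ∪ Gs) := by
        intro u hu
        rw [Finset.mem_filter] at hu
        by_cases hJu : u ∈ J
        · by_cases hS'u : u ∈ S'
          · exact Finset.mem_union_right _ (Finset.mem_union_left _
              (Finset.mem_filter.2 ⟨hS'u, hu.2⟩))
          · exact Finset.mem_union_right _ (Finset.mem_union_right _
              (Finset.mem_filter.2 ⟨Finset.mem_sdiff.2 ⟨hJu, hS'u⟩, hu.2⟩))
        · exact Finset.mem_union_left _ (Finset.mem_sdiff.2 ⟨hu.1, hJu⟩)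
      have h3 := Finset.card_le_card this
      have h4 := Finset.card_union_le (S \ J) (S'.filter (fun u => esc G K b0 u {p, t}) ∪ Gs)
      have h5 := Finset.card_union_le (S'.filter (fun u => esc G K b0 u {p, t})) Gs
      have h6 : (k+1) * (G.cliqueNum + rr G) = k * (G.cliqueNum + rr G) + (G.cliqueNum + rr G) := by
        ring
      omega

noncomputable def beta (G : SimpleGraph V) : ℕ :=
  G.cliqueNum * (G.cliqueNum + rr G) + 2 * G.cliqueNum

/-- for an extreme vertex `q`, a small independent set controlling nonneighbours of `q`. -/
theorem Inst.extreme [Fintype V] (hT : Paper.ThetaFree G) (hP : Paper.PyramidFree G)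
    (I : Inst G K B b0 T X) {q : V} (hq : q ∈ T) (W : Finset V) (hW : W ⊆ T)
    (hqW : esc G K b0 q W) (s0 : ℕ) (hs0 : (T \ W).card ≤ s0) :
    ∃ Q ⊆ T, Q.card ≤ 2 ∧ Paper.IsIndep G (Q : Set V) ∧
      (T.filter (fun t => esc G K b0 t Q ∧ ¬ G.Adj q t)).card ≤ s0 + beta G := by
  set Y := W.filter (fun y => ¬ G.Adj q y) with hYd
  have hqW' : q ∉ W := fun h => esc_self (Finset.mem_coe.2 h) hqW
  have hY : Y ⊆ T := (Finset.filter_subset _ _).trans hW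
  have main : ∀ Q : Finset V, (Y.filter (fun t => esc G K b0 t Q)).card ≤ beta G →
      (T.filter (fun t => esc G K b0 t Q ∧ ¬ G.Adj q t)).card ≤ s0 + beta G := by
    intro Q hQ
    have : T.filter (fun t => esc G K b0 t Q ∧ ¬ G.Adj q t) ⊆
        (T \ W) ∪ Y.filter (fun t => esc G K b0 t Q) := by
      intro t ht
      simp only [hYd, Finset.mem_filter, Finset.mem_union, Finset.mem_sdiff] at ht ⊢
      tauto
    have h3 := Finset.card_le_card this
    have h4 := Finset.card_union_le (T \ W) (Y.filter (fun t => esc G K b0 t Q))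
    omega
  by_cases hc : G.IsClique (Y : Set V)
  · refine ⟨{q}, by simpa using hq, by simp, ?_, main _ ?_⟩
    · intro a ha b hb hab
      simp at ha hb
      exact absurd (ha.trans hb.symm) hab
    · have h1 := clique_le hc
      have h2 := Finset.card_filter_le Y (fun t => esc G K b0 t ((({q} : Finset V)) : Set V))
      unfold beta
      omega
  · obtain ⟨t, htY, -, -, -, -, -, hcard⟩ := I.toolAux hT hP hq Y hY (fun y hy => by
        obtain ⟨h1, h2⟩ := Finset.mem_filter.1 hy
        exact ⟨fun h => hqW' (h ▸ h1), h2⟩) (fun f hf g hg _ _ => by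
        apply esc_mono _ hqW
        rintro s (rfl | rfl)
        · exact esc_self (Finset.mem_coe.2 (Finset.mem_filter.1 hf).1)
        · exact esc_self (Finset.mem_coe.2 (Finset.mem_filter.1 hg).1))
        G.cliqueNum Y le_rfl (fun C _ h => clique_le h) hc
    have htn : ¬ G.Adj q t := (Finset.mem_filter.1 htY).2
    refine ⟨{q, t}, ?_, Finset.card_le_two, ?_, main _ ?_⟩
    · intro y hy
      simp at hy
      rcases hy with rfl | rfl
      · exact hq
      · exact hY htY
    · intro a ha b hb hab
      simp at ha hb
      rcases ha with rfl | rfl <;> rcases hb with rfl | rfl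
      · exact absurd rfl hab
      · exact htn
      · exact fun h => htn h.symm
      · exact absurd rfl hab
    · unfold beta
      simpa using hcard

end Sep

open SimpleGraph

namespace Sep
open Classical

variable {V : Type*} {G : SimpleGraph V} {K B : Set V} {b0 : V} {T X : Finset V}

theorem conn_boundary (hK : Conn G K) {L : Set V} {b v : V} (hb : b ∈ K) (hbL : b ∈ L) (hv : v ∈ K)
    (hvL : v ∉ L) : ∃ x ∈ L, ∃ y ∈ K, y ∉ L ∧ G.Adj x y := by
  by_contra hcon
  push Not at hcon
  apply hvL
  refine (hK b hb v hv).ind L hbL ?_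
  intro x hx y hy a
  by_contra hyL
  exact hcon x hx y hy hyL a

theorem Inst.b0K (I : Inst G K B b0 T X) : b0 ∈ K := I.BK I.bB

theorem Inst.B_KS (I : Inst G K B b0 T X) {S : Set V} (hS : S ⊆ T) : B ⊆ KS G K b0 S :=
  conn_sub_comp I.cB I.bB (fun y hy => ⟨I.BK hy, fun s hs => I.TB s (hS hs) y hy⟩)

theorem Inst.ext1 [Fintype V] (hT : Paper.ThetaFree G) (I : Inst G K B b0 T X) (T' : Finset V)
    (hT' : T' ⊆ T) : (∀ t ∈ T', ¬ esc G K b0 t ∅) ∨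
      ∃ p ∈ T', ∃ W ⊆ T', (T' \ W).card ≤ 2 * rr G ∧ esc G K b0 p W := by
  by_cases h : K ⊆ KS G K b0 T'
  · left
    rintro t ht ⟨v, hv, a⟩
    exact KS_n (h (KS_sub hv)) (Finset.mem_coe.2 ht) a
  · right
    obtain ⟨v, hvK, hv⟩ := Set.not_subset.1 h
    obtain ⟨x, hx, d, hdK, hd, a⟩ := conn_boundary I.cK I.b0K
      (I.B_KS (by exact_mod_cast hT') I.bB) hvK hv
    have hex : ∃ p ∈ T', G.Adj p d := by
      by_contra hcon
      push Not at hcon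
      exact hd (comp_step hx a ⟨hdK, fun s hs => hcon s hs⟩)
    obtain ⟨p, hp, apd⟩ := hex
    refine ⟨p, hp, T'.filter (fun t => ¬ G.Adj d t), Finset.filter_subset _ _, ?_, d, ?_, apd⟩
    · refine le_trans (Finset.card_le_card ?_) (I.deg hT hdK)
      intro t ht
      simp only [Finset.mem_sdiff, Finset.mem_filter] at ht ⊢
      exact ⟨hT' ht.1, by tauto⟩
    · refine comp_step (v := x) ?_ a ⟨hdK, ?_⟩
      · refine KS_anti ?_ hx
        intro s hs
        exact esc_self (Finset.mem_coe.2 (Finset.mem_filter.1 (Finset.mem_coe.1 hs)).1)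
      · intro s hs h
        exact (Finset.mem_filter.1 (Finset.mem_coe.1 hs)).2 h.symm

theorem Inst.exts [Fintype V] (hT : Paper.ThetaFree G) (I : Inst G K B b0 T X) (j : ℕ) :
    (T.filter (fun t => esc G K b0 t ∅)).card ≤ j ∨
      ∃ P ⊆ T, P.card = j ∧ ∀ p ∈ P, ∃ W ⊆ T, (T \ W).card ≤ 2 * rr G + j ∧ esc G K b0 p W := by
  induction j with
  | zero => exact Or.inr ⟨∅, by simp, by simp, by simp⟩
  | succ j ih =>
    rcases ih with h | ⟨P, hP, hc, hPW⟩
    · left; omega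
    rcases I.ext1 hT (T \ P) Finset.sdiff_subset with h | ⟨p, hp, W, hW, hWc, he⟩
    · left
      have : T.filter (fun t => esc G K b0 t ∅) ⊆ P := by
        intro t ht
        obtain ⟨h1, h2⟩ := Finset.mem_filter.1 ht
        by_contra h3
        exact h t (Finset.mem_sdiff.2 ⟨h1, h3⟩) h2
      have := Finset.card_le_card this
      omega
    · right
      obtain ⟨hpT, hpP⟩ := Finset.mem_sdiff.1 hp
      refine ⟨insert p P, ?_, by rw [Finset.card_insert_of_notMem hpP, hc], ?_⟩
      · exact Finset.insert_subset hpT hP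
      · intro p' hp'
        rcases Finset.mem_insert.1 hp' with rfl | hp'
        · refine ⟨W, hW.trans Finset.sdiff_subset, ?_, he⟩
          have : T \ W ⊆ ((T \ P) \ W) ∪ P := by
            intro t ht
            simp only [Finset.mem_sdiff, Finset.mem_union] at ht ⊢
            tauto
          have h3 := Finset.card_le_card this
          have h4 := Finset.card_union_le ((T \ P) \ W) P
          omega
        · obtain ⟨W', h1, h2, h3⟩ := hPW p' hp'
          exact ⟨W', h1, by omega, h3⟩

theorem bad_le [Fintype V] (hT : Paper.ThetaFree G) (A M : Finset V) (c : ℕ)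
    (h : 3 * c + G.cliqueNum + 1 ≤ M.card) :
    (A.filter (fun a => (M.filter (fun m => ¬ G.Adj a m)).card ≤ c)).card ≤ rr G := by
  by_contra hlt
  obtain ⟨x, hx, y, hy, z, hz, ht⟩ := tri_exists (G := G) _ (not_le.1 hlt)
  have hx := (Finset.mem_filter.1 hx).2
  have hy := (Finset.mem_filter.1 hy).2
  have hz := (Finset.mem_filter.1 hz).2
  set M' := M.filter (fun m => G.Adj x m ∧ G.Adj y m ∧ G.Adj z m) with hM'
  have hsub : M ⊆ (M' ∪ M.filter (fun m => ¬ G.Adj x m)) ∪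
      (M.filter (fun m => ¬ G.Adj y m) ∪ M.filter (fun m => ¬ G.Adj z m)) := by
    intro m hm
    simp only [hM', Finset.mem_union, Finset.mem_filter]
    tauto
  have h1 := Finset.card_le_card hsub
  have h2 := Finset.card_union_le (M' ∪ M.filter (fun m => ¬ G.Adj x m))
      (M.filter (fun m => ¬ G.Adj y m) ∪ M.filter (fun m => ¬ G.Adj z m))
  have h3 := Finset.card_union_le M' (M.filter (fun m => ¬ G.Adj x m))
  have h4 := Finset.card_union_le (M.filter (fun m => ¬ G.Adj y m)) (M.filter (fun m => ¬ G.Adj z m))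
  obtain ⟨f, hf, f', hf', hne, hn⟩ := pair_exists (G := G) M' (by omega)
  have hf := (Finset.mem_filter.1 hf).2
  have hf' := (Finset.mem_filter.1 hf').2
  exact k23 hT hne hn ht hf.1.symm hf.2.1.symm hf.2.2.symm hf'.1.symm hf'.2.1.symm hf'.2.2.symm

theorem sel [Fintype V] (hT : Paper.ThetaFree G) (M1 M2 M3 : Finset V)
    (h1 : 4 * rr G + 1 ≤ M1.card) (h2 : 4 * rr G + 1 ≤ M2.card) (h3 : 4 * rr G + 1 ≤ M3.card) :
    ∃ a ∈ M1, ∃ b ∈ M2, ∃ c ∈ M3, ¬ G.Adj a b ∧ ¬ G.Adj a c ∧ ¬ G.Adj b c := by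
  have hw := w_le_rr (G := G)
  have b2 := bad_le hT M1 M2 (rr G) (by omega)
  have b3 := bad_le hT M1 M3 (rr G) (by omega)
  have : ∃ a ∈ M1, rr G < (M2.filter (fun m => ¬ G.Adj a m)).card ∧
      rr G < (M3.filter (fun m => ¬ G.Adj a m)).card := by
    by_contra hcon
    push Not at hcon
    have hsub : M1 ⊆ M1.filter (fun a => (M2.filter (fun m => ¬ G.Adj a m)).card ≤ rr G) ∪
        M1.filter (fun a => (M3.filter (fun m => ¬ G.Adj a m)).card ≤ rr G) := by
      intro a ha
      rw [Finset.mem_union, Finset.mem_filter, Finset.mem_filter]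
      by_cases h : (M2.filter (fun m => ¬ G.Adj a m)).card ≤ rr G
      · exact Or.inl ⟨ha, h⟩
      · exact Or.inr ⟨ha, hcon a ha (not_le.1 h)⟩
    have := Finset.card_le_card hsub
    have := Finset.card_union_le (M1.filter (fun a => (M2.filter (fun m => ¬ G.Adj a m)).card ≤ rr G))
        (M1.filter (fun a => (M3.filter (fun m => ¬ G.Adj a m)).card ≤ rr G))
    omega
  obtain ⟨a, ha, ha2, ha3⟩ := this
  set M2' := M2.filter (fun m => ¬ G.Adj a m) with hM2'
  set M3' := M3.filter (fun m => ¬ G.Adj a m) with hM3'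
  have b4 := bad_le hT M2' M3' 0 (by omega)
  have : ∃ b ∈ M2', 0 < (M3'.filter (fun m => ¬ G.Adj b m)).card := by
    by_contra hcon
    push Not at hcon
    rw [Finset.filter_true_of_mem hcon] at b4
    omega
  obtain ⟨b, hb, hb'⟩ := this
  obtain ⟨c, hc⟩ := Finset.card_pos.1 hb'
  obtain ⟨hc3, hbc⟩ := Finset.mem_filter.1 hc
  obtain ⟨hcM, hac⟩ := Finset.mem_filter.1 hc3
  obtain ⟨hbM, hab⟩ := Finset.mem_filter.1 hb
  exact ⟨a, ha, b, hbM, c, hcM, hab, hac, hbc⟩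

noncomputable def beta2 (G : SimpleGraph V) : ℕ := 3 * (3 * rr G + 1 + beta G) + 6 * rr G

theorem Inst.Mcard [Fintype V] (hT : Paper.ThetaFree G)
    (Q1 Q2 Q3 : Set V) (q1 q2 q3 : V) (s : ℕ)
    (n12 : q1 ≠ q2) (n13 : q1 ≠ q3) (m12 : ¬ G.Adj q1 q2) (m13 : ¬ G.Adj q1 q3)
    (h1 : (T.filter (fun t => esc G K b0 t Q1 ∧ ¬ G.Adj q1 t)).card ≤ s)
    (h2 : (T.filter (fun t => esc G K b0 t Q2 ∧ ¬ G.Adj q2 t)).card ≤ s)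
    (h3 : (T.filter (fun t => esc G K b0 t Q3 ∧ ¬ G.Adj q3 t)).card ≤ s)
    (hbig : 3 * s + 6 * rr G < (T.filter (fun t => esc G K b0 t Q1)).card) :
    4 * rr G + 1 ≤ (T.filter (fun t => esc G K b0 t Q1 ∧ ¬ esc G K b0 t Q2 ∧
      ¬ esc G K b0 t Q3)).card := by
  have c2 := common_le hT n12 m12 (T.filter (fun t => G.Adj q1 t ∧ G.Adj q2 t))
    (fun s hs => (Finset.mem_filter.1 hs).2)
  have c3 := common_le hT n13 m13 (T.filter (fun t => G.Adj q1 t ∧ G.Adj q3 t))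
    (fun s hs => (Finset.mem_filter.1 hs).2)
  have hsub : T.filter (fun t => esc G K b0 t Q1) ⊆
      ((T.filter (fun t => esc G K b0 t Q1 ∧ ¬ esc G K b0 t Q2 ∧ ¬ esc G K b0 t Q3)) ∪
      (T.filter (fun t => esc G K b0 t Q1 ∧ ¬ G.Adj q1 t))) ∪
      (((T.filter (fun t => esc G K b0 t Q2 ∧ ¬ G.Adj q2 t)) ∪
      (T.filter (fun t => esc G K b0 t Q3 ∧ ¬ G.Adj q3 t))) ∪
      ((T.filter (fun t => G.Adj q1 t ∧ G.Adj q2 t)) ∪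
      (T.filter (fun t => G.Adj q1 t ∧ G.Adj q3 t)))) := by
    intro t ht
    simp only [Finset.mem_union, Finset.mem_filter] at ht ⊢
    tauto
  have := Finset.card_le_card hsub
  grind [Finset.card_union_le]

theorem Inst.H2 [Fintype V] (hT : Paper.ThetaFree G) (hP : Paper.PyramidFree G)
    (I : Inst G K B b0 T X) : ∃ Q ⊆ T, Q.card ≤ 2 ∧ Paper.IsIndep G (Q : Set V) ∧
      (T.filter (fun t => esc G K b0 t Q)).card ≤ beta2 G := by
  rcases I.exts hT (rr G + 1) with h | ⟨P, hPT, hPc, hPW⟩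
  · refine ⟨∅, by simp, by simp, by intro a ha; simp at ha, ?_⟩
    have : (T.filter (fun t => esc G K b0 t ((∅ : Finset V) : Set V))).card ≤ rr G + 1 := by
      simpa using h
    unfold beta2
    omega
  by_contra hcon
  push Not at hcon
  obtain ⟨q1, hq1, q2, hq2, q3, hq3, tri⟩ := tri_exists (G := G) P (by omega)
  obtain ⟨W1, hW1, hc1, he1⟩ := hPW q1 hq1
  obtain ⟨W2, hW2, hc2, he2⟩ := hPW q2 hq2
  obtain ⟨W3, hW3, hc3, he3⟩ := hPW q3 hq3
  obtain ⟨Q1, Q1T, Q1c, Q1i, Q1s⟩ := I.extreme hT hP (hPT hq1) W1 hW1 he1 _ hc1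
  obtain ⟨Q2, Q2T, Q2c, Q2i, Q2s⟩ := I.extreme hT hP (hPT hq2) W2 hW2 he2 _ hc2
  obtain ⟨Q3, Q3T, Q3c, Q3i, Q3s⟩ := I.extreme hT hP (hPT hq3) W3 hW3 he3 _ hc3
  have B1 := hcon Q1 Q1T Q1c Q1i
  have B2 := hcon Q2 Q2T Q2c Q2i
  have B3 := hcon Q3 Q3T Q3c Q3i
  have es : 2 * rr G + (rr G + 1) + beta G = 3 * rr G + 1 + beta G := by ring
  rw [es] at Q1s Q2s Q3s
  unfold beta2 at B1 B2 B3
  obtain ⟨n12, n13, n23, m12, m13, m23⟩ := tri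
  have M1 := Inst.Mcard hT Q1 Q2 Q3 q1 q2 q3 _ n12 n13 m12 m13 Q1s Q2s Q3s B1
  have M2 := Inst.Mcard hT Q2 Q1 Q3 q2 q1 q3 _ n12.symm n23 (fun h => m12 h.symm) m23 Q2s Q1s Q3s B2
  have M3 := Inst.Mcard hT Q3 Q1 Q2 q3 q1 q2 _ n13.symm n23.symm (fun h => m13 h.symm)
    (fun h => m23 h.symm) Q3s Q1s Q2s B3
  obtain ⟨a, ha, b, hb, c, hc, hab, hac, hbc⟩ := sel hT _ _ _ M1 M2 M3
  obtain ⟨aT, a1, a2, a3⟩ := Finset.mem_filter.1 ha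
  obtain ⟨bT, b2, b1, b3⟩ := Finset.mem_filter.1 hb
  obtain ⟨cT, c3, c1, c2⟩ := Finset.mem_filter.1 hc
  refine I.TC hT hP aT bT cT ⟨?_, ?_, ?_, hab, hac, hbc⟩ (esc_mono ?_ a1) (esc_mono ?_ b2)
    (esc_mono ?_ c3)
  · rintro rfl; exact b1 a1
  · rintro rfl; exact c1 a1
  · rintro rfl; exact c2 b2
  · rintro s (rfl | rfl) <;> assumption
  · rintro s (rfl | rfl) <;> assumption
  · rintro s (rfl | rfl) <;> assumption

end Sep

open SimpleGraph

namespace Sep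
open Classical

variable {V : Type*} {G : SimpleGraph V} {K B : Set V} {b0 : V} {T X : Finset V}

theorem low_in (I : Finset V) (E : V → V → Prop) (hE : ∀ v ∈ I, (I.filter (fun u => E v u)).card ≤ 4)
    (hI : I.Nonempty) : ∃ v ∈ I, (I.filter (fun u => E u v)).card ≤ 4 := by
  by_contra hcon
  push Not at hcon
  have h := Finset.sum_card_bipartiteAbove_eq_sum_card_bipartiteBelow (s := I) (t := I) E
  have h1 : ∑ a ∈ I, (Finset.bipartiteAbove E I a).card ≤ I.card * 4 := by
    rw [← smul_eq_mul]
    exact Finset.sum_le_card_nsmul _ _ _ hE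
  have h2 : I.card * 5 ≤ ∑ a ∈ I, (Finset.bipartiteBelow E I a).card := by
    rw [← smul_eq_mul]
    exact Finset.card_nsmul_le_sum _ _ _ (fun a ha => hcon a ha)
  have := hI.card_pos
  omega

theorem free_step (I : Finset V) (E : V → V → Prop)
    (hE : ∀ v ∈ I, (I.filter (fun u => E v u)).card ≤ 4) (hI : I.Nonempty) :
    ∃ v ∈ I, I.card ≤ (I.filter (fun u => u ≠ v ∧ ¬ E v u ∧ ¬ E u v)).card + 9 := by
  obtain ⟨v, hv, h⟩ := low_in I E hE hI
  refine ⟨v, hv, ?_⟩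
  have h' := hE v hv
  have hsub : I ⊆ I.filter (fun u => u ≠ v ∧ ¬ E v u ∧ ¬ E u v) ∪
      ({v} ∪ (I.filter (fun u => E v u) ∪ I.filter (fun u => E u v))) := by
    intro u hu
    simp only [Finset.mem_union, Finset.mem_filter, Finset.mem_singleton]
    tauto
  have h1 := Finset.card_le_card hsub
  have h2 := Finset.card_union_le (I.filter (fun u => u ≠ v ∧ ¬ E v u ∧ ¬ E u v))
    ({v} ∪ (I.filter (fun u => E v u) ∪ I.filter (fun u => E u v)))
  have h3 := Finset.card_union_le {v} (I.filter (fun u => E v u) ∪ I.filter (fun u => E u v))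
  have h4 := Finset.card_union_le (I.filter (fun u => E v u)) (I.filter (fun u => E u v))
  rw [Finset.card_singleton] at h3
  omega

theorem free_three (I : Finset V) (E : V → V → Prop)
    (hE : ∀ v ∈ I, (I.filter (fun u => E v u)).card ≤ 4) (hI : 19 ≤ I.card) :
    ∃ a ∈ I, ∃ b ∈ I, ∃ c ∈ I, a ≠ b ∧ a ≠ c ∧ b ≠ c ∧ ¬ E a b ∧ ¬ E b a ∧ ¬ E a c ∧ ¬ E c a ∧
      ¬ E b c ∧ ¬ E c b := by
  obtain ⟨a, ha, h1⟩ := free_step I E hE (Finset.card_pos.1 (by omega))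
  set I1 := I.filter (fun u => u ≠ a ∧ ¬ E a u ∧ ¬ E u a) with hI1
  have hs : I1 ⊆ I := Finset.filter_subset _ _
  obtain ⟨b, hb, h2⟩ := free_step I1 E (fun v hv =>
    (Finset.card_le_card (Finset.filter_subset_filter _ hs)).trans (hE v (hs hv)))
    (Finset.card_pos.1 (by omega))
  obtain ⟨c, hc⟩ := Finset.card_pos.1 (show 0 < (I1.filter (fun u => u ≠ b ∧ ¬ E b u ∧ ¬ E u b)).card by omega)
  obtain ⟨hc1, c1, c2, c3⟩ := Finset.mem_filter.1 hc
  obtain ⟨hcI, c4, c5, c6⟩ := Finset.mem_filter.1 hc1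
  obtain ⟨hbI, b4, b5, b6⟩ := Finset.mem_filter.1 hb
  exact ⟨a, ha, b, hbI, c, hcI, b4.symm, c4.symm, c1.symm, b5, b6, c5, c6, c2, c3⟩

theorem Inst.near [Fintype V] (hT : Paper.ThetaFree G) (hP : Paper.PyramidFree G)
    (I : Inst G K B b0 T X) :
    (T.filter (fun t => ∃ d ∈ K, (∃ y ∈ B, G.Adj y d) ∧ G.Adj t d)).card ≤ (G.cliqueNum + 1) ^ 18 := by
  by_contra hlt
  obtain ⟨J, hJ, hi, hc⟩ := indep_exists (G := G) 18 _ (not_le.1 hlt)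
  have hJT : J ⊆ T := hJ.trans (Finset.filter_subset _ _)
  have hex : ∀ t, ∃ d, t ∈ J → d ∈ K ∧ (∃ y ∈ B, G.Adj y d) ∧ G.Adj t d := by
    intro t
    by_cases h : t ∈ J
    · obtain ⟨d, h1, h2, h3⟩ := (Finset.mem_filter.1 (hJ h)).2
      exact ⟨d, fun _ => ⟨h1, h2, h3⟩⟩
    · exact ⟨t, fun h' => absurd h' h⟩
  choose d hd using hex
  obtain ⟨t1, h1, t2, h2, t3, h3, n12, n13, n23, e12, e21, e13, e31, e23, e32⟩ :=
    free_three J (fun t t' => G.Adj (d t) t') (fun t ht => I.deg' hT (hd t ht).1 J hJT hi) hc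
  obtain ⟨k1, ⟨y1, hy1, ay1⟩, a1⟩ := hd t1 h1
  obtain ⟨k2, ⟨y2, hy2, ay2⟩, a2⟩ := hd t2 h2
  obtain ⟨k3, ⟨y3, hy3, ay3⟩, a3⟩ := hd t3 h3
  have cD : Conn G (insert (d t1) (insert (d t2) (insert (d t3) B))) :=
    conn_insert (conn_insert (conn_insert I.cB hy3 ay3) (Or.inr hy2) ay2)
      (Or.inr (Or.inr hy1)) ay1
  have v1 : ∀ z ∈ insert (d t1) (insert (d t2) (insert (d t3) B)), G.Adj t1 z → z = d t1 := by
    rintro z (rfl | rfl | rfl | hz) a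
    · rfl
    · exact absurd a.symm e21
    · exact absurd a.symm e31
    · exact absurd a (I.TB t1 (hJT h1) z hz)
  have v2 : ∀ z ∈ insert (d t1) (insert (d t2) (insert (d t3) B)), G.Adj t2 z → z = d t2 := by
    rintro z (rfl | rfl | rfl | hz) a
    · exact absurd a.symm e12
    · rfl
    · exact absurd a.symm e32
    · exact absurd a (I.TB t2 (hJT h2) z hz)
  have v3 : ∀ z ∈ insert (d t1) (insert (d t2) (insert (d t3) B)), G.Adj t3 z → z = d t3 := by
    rintro z (rfl | rfl | rfl | hz) a
    · exact absurd a.symm e13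
    · exact absurd a.symm e23
    · rfl
    · exact absurd a (I.TB t3 (hJT h3) z hz)
  refine I.core hT hP (hJT h1) (hJT h2) (hJT h3)
    ⟨n12, n13, n23, hi h1 h2 n12, hi h1 h3 n13, hi h2 h3 n23⟩ cD ?_
    ⟨d t1, by simp, a1⟩ ⟨d t2, by simp, a2⟩ ⟨d t3, by simp, a3⟩
    (fun d hd d' hd' a a' hne => absurd ((v1 d hd a).trans (v1 d' hd' a').symm) hne)
    (fun d hd d' hd' a a' hne => absurd ((v2 d hd a).trans (v2 d' hd' a').symm) hne)
    (fun d hd d' hd' a a' hne => absurd ((v3 d hd a).trans (v3 d' hd' a').symm) hne)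
  rintro z (rfl | rfl | rfl | hz)
  · exact k1
  · exact k2
  · exact k3
  · exact I.BK hz

noncomputable def gam (G : SimpleGraph V) : ℕ := (G.cliqueNum + 1) ^ 18 + beta2 G + rr G

/-- links between the new roots -/
theorem Inst.newLink (I : Inst G K B b0 T X) {q q' : V} (hq : q ∈ T) (hq' : q' ∈ T) (hne : q ≠ q')
    (hn : ¬ G.Adj q q') : Link G q q' K := by
  obtain ⟨x, hx, a⟩ := I.TX q hq
  obtain ⟨x', hx', a'⟩ := I.TX q' hq'
  by_cases hxq : G.Adj x q'
  · refine ⟨x, {q'}, a.symm, conn_singleton _, rfl, hne, ?_, ⟨q', rfl, hxq⟩, ?_, I.XK x hx, I.XK' x hx, ?_⟩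
    · rintro y rfl; exact hn
    · rintro y rfl y' rfl _ _ h; exact absurd rfl h
    · intro y hy h; exact absurd hy h
  · have hxx : x ≠ x' := by rintro rfl; exact hxq a'
    obtain ⟨u, A, l1, l2, l3, l4, l5, ⟨y0, hy0, ay0⟩, l7, l8, l9, l10⟩ := I.link x hx x' hx' hxx
    have xN : ∀ y ∈ insert u (insert q' A), G.Adj x y → y = u := by
      rintro y (rfl | rfl | hy) b
      · rfl
      · exact absurd b hxq
      · exact absurd b (l5 y hy)
    refine ⟨x, insert u (insert q' A), a.symm,
      conn_insert (conn_insert l2 l3 a') (Or.inr hy0) ay0.symm, by simp, ?_, ?_,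
      ⟨u, by simp, l1⟩, ?_, I.XK x hx, I.XK' x hx, ?_⟩
    · rintro (rfl | h | h)
      · exact l8 (Or.inl hq)
      · exact hne h
      · exact l5 q h a
    · rintro y (rfl | rfl | hy) b
      · exact l9 q (Or.inl hq) b.symm
      · exact hn b
      · by_cases e : y = x'
        · subst e; exact I.one x hx y hx' hxx q hq a b.symm
        · exact l10 y hy e q (Or.inl hq) b.symm
    · intro y hy y' hy' b b' h
      exact absurd ((xN y hy b).trans (xN y' hy' b').symm) h
    · rintro y (rfl | rfl | hy) h f hf
      · exact l9 f (Or.inr hf)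
      · exact absurd rfl h
      · by_cases e : y = x'
        · subst e; exact I.XK' y hx' f hf
        · exact l10 y hy e f (Or.inr hf)

theorem recursion [Fintype V] (hT : Paper.ThetaFree G) (hP : Paper.PyramidFree G) (k : ℕ) :
    ∀ (K B : Set V) (b0 : V) (T X : Finset V), Inst G K B b0 T X → (K \ B).ncard < 2 ^ k →
      ∃ C : Finset V, (∀ c ∈ C, c ∉ B) ∧ C.card ≤ gam G * k ∧
        ∀ v ∈ comp G (K \ ↑C) b0, ∀ t ∈ T, t ∉ C → ¬ G.Adj t v := by
  induction k with
  | zero =>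
    intro K B b0 T X I hk
    refine ⟨∅, by simp, by simp, ?_⟩
    intro v hv t ht _
    apply I.TB t ht
    have hvK : v ∈ K := (comp_sub hv).1
    by_contra hvB
    have : (K \ B).ncard = 0 := by simpa using hk
    rw [Set.ncard_eq_zero (Set.toFinite _)] at this
    have h2 : v ∈ K \ B := ⟨hvK, hvB⟩
    rw [this] at h2
    exact h2
  | succ k ih =>
    intro K B b0 T X I hk
    set C0 := T.filter (fun t => ∃ d ∈ K, (∃ y ∈ B, G.Adj y d) ∧ G.Adj t d) with hC0
    have hC0c : C0.card ≤ (G.cliqueNum + 1) ^ 18 := I.near hT hP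
    set T0 := T \ C0 with hT0
    have hT0T : T0 ⊆ T := Finset.sdiff_subset
    have I0 : Inst G K B b0 T0 X := I.mono le_rfl I.cK I.cB I.BK I.bB hT0T
      (fun t ht => I.TB t (hT0T ht))
    obtain ⟨Q, hQT, hQ2, hQi, hQc⟩ := I0.H2 hT hP
    set C1 := T0.filter (fun t => esc G K b0 t Q) with hC1
    set K' := KS G K b0 Q with hK'
    have hK'K : K' ⊆ K := KS_sub
    have hBK' : B ⊆ K' := I0.B_KS (by exact_mod_cast hQT)
    have hb' : b0 ∈ K' := hBK' I.bB
    have cK' : Conn G K' := comp_conn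
    have hdone : ∀ t ∈ T, t ∉ C0 → t ∉ C1 → ∀ v ∈ K', ¬ G.Adj t v := by
      intro t ht h0 h1 v hv a
      exact h1 (Finset.mem_filter.2 ⟨Finset.mem_sdiff.2 ⟨ht, h0⟩, v, hv, a⟩)
    have hTB : ∀ t ∈ T, t ∉ B := fun t ht h => I.TK ht (I.BK h)
    have hsum : (K \ K').ncard + (K' \ B).ncard ≤ (K \ B).ncard := by
      rw [← Set.ncard_union_eq _ (Set.toFinite _) (Set.toFinite _)]
      · apply Set.ncard_le_ncard _ (Set.toFinite _)
        rintro v (⟨h1, h2⟩ | ⟨h1, h2⟩)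
        · exact ⟨h1, fun h => h2 (hBK' h)⟩
        · exact ⟨hK'K h1, h2⟩
      · rw [Set.disjoint_left]
        rintro v ⟨_, h2⟩ ⟨h1, _⟩
        exact h2 h1
    have h2k : 2 ^ (k+1) = 2 ^ k + 2 ^ k := by ring
    have hgk : gam G * (k+1) = gam G * k + ((G.cliqueNum + 1) ^ 18 + beta2 G + rr G) := by
      unfold gam; ring
    rcases (show (K \ K').ncard < 2 ^ k ∨ (K' \ B).ncard < 2 ^ k by omega) with hA | hB
    · -- option A
      have IA : Inst G K K' b0 (T0 \ C1) X := I0.mono le_rfl I.cK cK' hK'K hb' Finset.sdiff_subset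
        (by
          intro t ht v hv
          obtain ⟨h1, h2⟩ := Finset.mem_sdiff.1 ht
          obtain ⟨h3, h4⟩ := Finset.mem_sdiff.1 h1
          exact hdone t h3 h4 h2 v hv)
      obtain ⟨C', hC'B, hC'c, hC'⟩ := ih K K' b0 _ X IA hA
      refine ⟨C0 ∪ C1 ∪ C', ?_, ?_, ?_⟩
      · intro c hc
        rcases Finset.mem_union.1 hc with hc | hc
        · rcases Finset.mem_union.1 hc with hc | hc
          · exact hTB c (Finset.mem_filter.1 hc).1
          · exact hTB c (hT0T (Finset.mem_filter.1 hc).1)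
        · exact fun h => hC'B c hc (hBK' h)
      · have h1 := Finset.card_union_le (C0 ∪ C1) C'
        have h2 := Finset.card_union_le C0 C1
        omega
      · intro v hv t ht htC
        simp only [Finset.mem_union, not_or] at htC
        refine hC' v (comp_mono ?_ hv) t ?_ htC.2
        · rintro z ⟨h1, h2⟩
          refine ⟨h1, fun h => h2 ?_⟩
          simp only [Finset.coe_union]
          exact Or.inr h
        · exact Finset.mem_sdiff.2 ⟨Finset.mem_sdiff.2 ⟨ht, htC.1.1⟩, htC.1.2⟩
    · -- option B
      set bd : Finset V := Finset.univ.filter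
        (fun d => d ∈ K ∧ d ∉ K' ∧ ∃ v ∈ K', G.Adj v d) with hbd
      set cm := bd.filter (fun d => ∃ q ∈ Q, ∃ q' ∈ Q, q ≠ q' ∧ G.Adj q d ∧ G.Adj q' d) with hcm
      have hcmc : cm.card ≤ rr G := by
        by_cases h : ∃ q ∈ Q, ∃ q' ∈ Q, q ≠ q'
        · obtain ⟨q, hq, q', hq', hne⟩ := h
          refine common_le hT hne (hQi hq hq' hne) cm ?_
          have hQe : ∀ z ∈ Q, z = q ∨ z = q' := by
            intro z hz
            by_contra hcon
            push Not at hcon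
            have : 2 < Q.card := Finset.two_lt_card_iff.2
              ⟨z, q, q', hz, hq, hq', hcon.1, hcon.2, hne⟩
            omega
          intro s hs
          obtain ⟨_, p, hp, p', hp', hpp, a, a'⟩ := Finset.mem_filter.1 hs
          rcases hQe p hp with rfl | rfl <;> rcases hQe p' hp' with rfl | rfl
          · exact absurd rfl hpp
          · exact ⟨a, a'⟩
          · exact ⟨a', a⟩
          · exact absurd rfl hpp
        · have : cm = ∅ := by
            rw [Finset.eq_empty_iff_forall_notMem]
            intro s hs
            obtain ⟨_, p, hp, p', hp', hpp, _⟩ := Finset.mem_filter.1 hs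
            exact h ⟨p, hp, p', hp', hpp⟩
          simp [this]
      have hbdQ : ∀ d ∈ bd, ∃ q ∈ Q, G.Adj q d := by
        intro d hd
        obtain ⟨_, h1, h2, v, hv, a⟩ := Finset.mem_filter.1 hd
        by_contra hcon
        push Not at hcon
        exact h2 (comp_step hv a ⟨h1, fun s hs => hcon s hs⟩)
      have hbdK : ∀ d ∈ bd, d ∈ K := fun d hd => (Finset.mem_filter.1 hd).2.1
      have IB : Inst G K' B b0 (bd \ cm) Q :=
        { cK := cK'
          cB := I.cB
          BK := hBK'
          bB := I.bB
          TB := by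
            intro d hd y hy a
            obtain ⟨h1, _⟩ := Finset.mem_sdiff.1 hd
            obtain ⟨q, hq, aq⟩ := hbdQ d h1
            obtain ⟨h3, h4⟩ := Finset.mem_sdiff.1 (hQT hq)
            exact h4 (Finset.mem_filter.2 ⟨h3, d, hbdK d h1, ⟨y, hy, a.symm⟩, aq⟩)
          X2 := hQ2
          XK := fun q hq h => I0.TK (hQT hq) (hK'K h)
          XK' := fun q hq y hy => KS_n hy (Finset.mem_coe.2 hq)
          TX := fun d hd => hbdQ d (Finset.mem_sdiff.1 hd).1
          one := by
            intro q hq q' hq' hne d hd a a'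
            obtain ⟨h1, h2⟩ := Finset.mem_sdiff.1 hd
            exact h2 (Finset.mem_filter.2 ⟨h1, q, hq, q', hq', hne, a, a'⟩)
          link := by
            intro q hq q' hq' hne
            refine (I0.newLink (hQT hq) (hQT hq') hne (hQi hq hq' hne)).mono ?_
            rintro z (hz | hz)
            · exact hbdK z (Finset.mem_sdiff.1 (Finset.mem_coe.1 hz)).1
            · exact hK'K hz }
      obtain ⟨C', hC'B, hC'c, hC'⟩ := ih K' B b0 _ Q IB hB
      refine ⟨C0 ∪ C1 ∪ (cm ∪ C'), ?_, ?_, ?_⟩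
      · intro c hc
        rcases Finset.mem_union.1 hc with hc | hc
        · rcases Finset.mem_union.1 hc with hc | hc
          · exact hTB c (Finset.mem_filter.1 hc).1
          · exact hTB c (hT0T (Finset.mem_filter.1 hc).1)
        · rcases Finset.mem_union.1 hc with hc | hc
          · intro h
            exact (Finset.mem_filter.1 (Finset.mem_filter.1 hc).1).2.2.1 (hBK' h)
          · exact hC'B c hc
      · have h1 := Finset.card_union_le (C0 ∪ C1) (cm ∪ C')
        have h2 := Finset.card_union_le C0 C1
        have h3 := Finset.card_union_le cm C'
        omega
      · intro v hv t ht htC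
        simp only [Finset.mem_union, not_or] at htC
        refine hdone t ht htC.1.1 htC.1.2 v ?_
        have : v ∈ comp G (K' \ ↑C') b0 := by
          refine RR.ind hv _ (comp_self ⟨hb', fun h => hC'B b0 h I.bB⟩) ?_
          rintro x hx y ⟨hyK, hyC⟩ a
          simp only [Finset.coe_union, Set.mem_union, not_or, Finset.mem_coe] at hyC
          have hyK' : y ∈ K' := by
            by_contra hyK'
            have hyb : y ∈ bd := Finset.mem_filter.2
              ⟨Finset.mem_univ _, hyK, hyK', x, (comp_sub hx).1, a⟩
            exact hC' x hx y (Finset.mem_sdiff.2 ⟨hyb, hyC.2.1⟩) hyC.2.2 a.symm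
          exact comp_step hx a ⟨hyK', fun h => hyC.2.2 h⟩
        exact (comp_sub this).1

end Sep

open SimpleGraph

namespace Sep
open Classical

theorem final {V : Type} [Fintype V] (G : SimpleGraph V) (hT : Paper.ThetaFree G)
    (hP : Paper.PyramidFree G) (a b : V) (hab : a ≠ b) (hn : ¬ G.Adj a b) :
    ∃ C : Finset V, a ∉ C ∧ b ∉ C ∧
      C.card ≤ rr G + gam G * (Nat.log 2 (Fintype.card V) + 1) ∧
      ∀ Wk : G.Walk a b, ∃ v ∈ Wk.support, v ∈ C := by
  set S : Set V := {v | v ≠ a ∧ ¬ G.Adj a v} with hS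
  have hbS : b ∈ S := ⟨hab.symm, hn⟩
  have I : Inst G (comp G S b) {b} b
      (Finset.univ.filter (fun t => G.Adj a t ∧ ¬ G.Adj b t)) {a} := by
    refine ⟨comp_conn, ?_, ?_, rfl, ?_, by simp, ?_, ?_, ?_, ?_, ?_⟩
    · exact conn_singleton b
    · rintro _ rfl; exact comp_self hbS
    · intro t ht y hy h
      rw [Set.mem_singleton_iff] at hy
      subst hy
      exact (Finset.mem_filter.1 ht).2.2 h.symm
    · intro x hx h
      rw [Finset.mem_singleton] at hx
      subst hx
      exact (comp_sub h).1 rfl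
    · intro x hx y hy h
      rw [Finset.mem_singleton] at hx
      subst hx
      exact (comp_sub hy).2 h
    · intro t ht
      exact ⟨a, by simp, (Finset.mem_filter.1 ht).2.1⟩
    · intro x hx x' hx' hne
      rw [Finset.mem_singleton] at hx hx'
      exact absurd (hx.trans hx'.symm) hne
    · intro x hx x' hx' hne
      rw [Finset.mem_singleton] at hx hx'
      exact absurd (hx.trans hx'.symm) hne
  have hk : (comp G S b \ {b}).ncard < 2 ^ (Nat.log 2 (Fintype.card V) + 1) := by
    refine lt_of_le_of_lt ?_ (Nat.lt_pow_succ_log_self (by norm_num) (Fintype.card V))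
    rw [← Nat.card_eq_fintype_card, ← Set.ncard_univ]
    exact Set.ncard_le_ncard (Set.subset_univ _) (Set.toFinite _)
  obtain ⟨C', hC1, hC2, hC3⟩ := recursion hT hP _ _ _ _ _ _ I hk
  refine ⟨Finset.univ.filter (fun v => G.Adj a v ∧ G.Adj b v) ∪ C'.erase a, ?_, ?_, ?_, ?_⟩
  · simp
  · simp only [Finset.mem_union, Finset.mem_filter, Finset.mem_erase, not_or]
    exact ⟨fun h => G.irrefl h.2.2, fun h => hC1 b h.2 rfl⟩
  · refine (Finset.card_union_le _ _).trans (add_le_add ?_ ((Finset.card_erase_le).trans hC2))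
    exact common_le hT hab hn _ (fun s hs => (Finset.mem_filter.1 hs).2)
  · intro Wk
    by_contra hcon
    push Not at hcon
    have hbU : b ∈ comp G (comp G S b \ ↑C') b :=
      comp_self ⟨comp_self hbS, fun h => hC1 b h rfl⟩
    have haU : a ∉ comp G (comp G S b \ ↑C') b := fun h => (comp_sub (comp_sub h).1).1 rfl
    obtain ⟨d, hd, h1, h2⟩ := Wk.reverse.exists_boundary_dart _ hbU haU
    have hw : d.snd ∈ Wk.support := by
      have := Wk.reverse.dart_snd_mem_support_of_mem_darts hd
      simpa using this
    have hadj := d.adj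
    generalize d.fst = v at *
    generalize d.snd = w at *
    have hwC := hcon w hw
    simp only [Finset.mem_union, Finset.mem_filter, Finset.mem_univ, true_and, Finset.mem_erase,
      not_or, not_and] at hwC
    have hvK := (comp_sub h1).1
    by_cases hwa : w = a
    · subst hwa; exact (comp_sub hvK).2 hadj.symm
    have hwC' := hwC.2 hwa
    by_cases haw : G.Adj a w
    · exact hC3 v h1 w (by simpa using ⟨haw, hwC.1 haw⟩) hwC' hadj.symm
    · exact h2 (comp_step h1 hadj ⟨comp_step hvK hadj ⟨hwa, haw⟩, hwC'⟩)

end Sep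

theorem small_pairwise_separator_omega :
    ∃ p : Polynomial ℕ, ∀ (V : Type) [Fintype V] (G : SimpleGraph V),
      Paper.ThetaFree G → Paper.PyramidFree G →
      ∀ a b : V, a ≠ b → ¬ G.Adj a b →
        ∃ C : Finset V, a ∉ C ∧ b ∉ C ∧
          (C.card : ℝ) ≤ ((p.eval G.cliqueNum : ℕ) : ℝ) * Real.logb 2 (Fintype.card V) ∧
          ∀ Wk : G.Walk a b, ∃ v ∈ Wk.support, v ∈ C := by
  let x : Polynomial ℕ := Polynomial.X
  let r : Polynomial ℕ := (x + 1) ^ 2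
  let be : Polynomial ℕ := x * (x + r) + 2 * x
  let be2 : Polynomial ℕ := 3 * (3 * r + 1 + be) + 6 * r
  let ga : Polynomial ℕ := (x + 1) ^ 18 + be2 + r
  refine ⟨2 * (r + ga), ?_⟩
  intro V _ G hT hP a b hab hn
  obtain ⟨C, h1, h2, h3, h4⟩ := Sep.final G hT hP a b hab hn
  refine ⟨C, h1, h2, ?_, h4⟩
  have he : (2 * (r + ga)).eval G.cliqueNum = 2 * (Sep.rr G + Sep.gam G) := by
    simp [r, ga, be2, be, x, Sep.rr, Sep.gam, Sep.beta2, Sep.beta]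
  rw [he]
  have hn2 : 2 ≤ Fintype.card V := by
    have : 1 < Fintype.card V := Fintype.one_lt_card_iff.2 ⟨a, b, hab⟩
    omega
  have hn2' : (2 : ℝ) ≤ (Fintype.card V : ℝ) := by exact_mod_cast hn2
  have hl1 : (1 : ℝ) ≤ Real.logb 2 (Fintype.card V) := by
    rw [Real.le_logb_iff_rpow_le (by norm_num) (by linarith)]
    simpa using hn2'
  have hl2 : ((Nat.log 2 (Fintype.card V) : ℕ) : ℝ) ≤ Real.logb 2 (Fintype.card V) := by
    have := Real.natLog_le_logb (Fintype.card V) 2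
    simpa using this
  have h3' : (C.card : ℝ) ≤ (Sep.rr G : ℝ) +
      (Sep.gam G : ℝ) * ((Nat.log 2 (Fintype.card V) : ℝ) + 1) := by exact_mod_cast h3
  have hr : (0 : ℝ) ≤ (Sep.rr G : ℝ) := Nat.cast_nonneg _
  have hg : (0 : ℝ) ≤ (Sep.gam G : ℝ) := Nat.cast_nonneg _
  push_cast
  nlinarith [mul_le_mul_of_nonneg_left hl2 hg, mul_le_mul_of_nonneg_left hl1 hg,
    mul_le_mul_of_nonneg_left hl1 hr]
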